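/- arXiv:1811.01724 — 15 statements merged into one kernel-verified Lean document; each statement's English description precedes it below -/
import Mathlib

section
/- Let n ≥ 1 and define the Ricci map Ric(t,s) = (2n t²/s², 2n + 2 − 2t/s) for t,s > 0. For every (t,s) ∈ (0,∞)² there exist a unique constant c > 0 and a unique sequence ((t_i,s_i))_{i≥1} of elements of (0,∞)² such that Ric(t₁,s₁) = (c t, c s) and Ric(t_{i+1},s_{i+1}) = (t_i,s_i) for all i ≥ 1. Moreover, (t_i,s_i) converges to (2n, 2n) as i → ∞. -/
open Filter Topology

/-- The Ricci map for the homogeneous metrics `g_{t,s}` on `S^{2n+1}`: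
`Ric(t,s) = (2n t²/s², 2n + 2 − 2t/s)`. -/
noncomputable def RicCP (n : ℕ) (p : ℝ × ℝ) : ℝ × ℝ :=
  (2 * n * p.1 ^ 2 / p.2 ^ 2, 2 * n + 2 - 2 * p.1 / p.2)

/-- The Ricci map depends only on the ratio `t / s`. -/
theorem ricCP_eq_ratio (n : ℕ) (p : ℝ × ℝ) :
    RicCP n p = (2 * n * (p.1 / p.2) ^ 2, 2 * (n + 1 - p.1 / p.2)) := by
  unfold RicCP
  ext <;> ring

theorem ratio_relation_of_ricCP {n : ℕ} {p q : ℝ × ℝ} (hq : 0 < q.2) (h : RicCP n p = q) :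
    q.1 / q.2 * (n + 1 - p.1 / p.2) = n * (p.1 / p.2) ^ 2 := by
  rw [ricCP_eq_ratio] at h
  subst h
  have hd : (n : ℝ) + 1 - p.1 / p.2 ≠ 0 := (pos_of_mul_pos_right hq two_pos.le).ne'
  rw [mul_assoc, mul_div_mul_left _ _ two_ne_zero, div_mul_cancel₀ _ hd]

/-- On positive reals the ratio of a metric is determined by the ratio of its Ricci curvature. -/
theorem ratio_relation_unique {N v u u' : ℝ} (hN : 0 < N) (hv : 0 < v) (hu : 0 < u) (hu' : 0 < u')
    (h : v * (N + 1 - u) = N * u ^ 2) (h' : v * (N + 1 - u') = N * u' ^ 2) : u = u' := by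
  have hprod : (u - u') * (N * (u + u') + v) = 0 := by linear_combination h' - h
  have hpos : 0 < N * (u + u') + v := by positivity
  linarith [(mul_eq_zero.mp hprod).resolve_right hpos.ne']

theorem exists_ratio_relation {N v : ℝ} (hN : 0 < N) (hv : 0 < v) :
    ∃ u, 0 < u ∧ v * (N + 1 - u) = N * u ^ 2 := by
  have hsq : Real.sqrt (v ^ 2 + 4 * N * (N + 1) * v) ^ 2 = v ^ 2 + 4 * N * (N + 1) * v :=
    Real.sq_sqrt (by positivity)
  have hlt : v < Real.sqrt (v ^ 2 + 4 * N * (N + 1) * v) :=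
    Real.lt_sqrt_of_sq_lt (lt_add_of_pos_right _ (by positivity))
  generalize Real.sqrt (v ^ 2 + 4 * N * (N + 1) * v) = r at hsq hlt
  refine ⟨(r - v) / (2 * N), div_pos (sub_pos.mpr hlt) (by positivity), ?_⟩
  field_simp
  linear_combination -hsq

theorem ratio_lt_of_relation {N v u : ℝ} (hN : 0 < N) (hv : 0 < v) (hu : 0 < u)
    (h : v * (N + 1 - u) = N * u ^ 2) : 0 < N + 1 - u :=
  pos_of_mul_pos_right (h ▸ by positivity) hv.le

theorem ratio_contracts {N v u : ℝ} (hN : 0 < N) (hv : 0 < v) (hu : 0 < u)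
    (h : v * (N + 1 - u) = N * u ^ 2) : (1 + u) * |u - 1| ≤ |v - 1| := by
  have hd := ratio_lt_of_relation hN hv hu h
  have hfac : |v - 1| * (N + 1 - u) = |u - 1| * (N * u + N + 1) := by
    rw [← abs_of_pos hd, ← abs_of_pos (show 0 < N * u + N + 1 by positivity), ← abs_mul, ← abs_mul]
    congr 1
    linear_combination h
  refine le_of_mul_le_mul_right ?_ hd
  rw [hfac, mul_right_comm, mul_comm]
  exact mul_le_mul_of_nonneg_left (by nlinarith [sq_nonneg u]) (abs_nonneg _)

theorem le_ratio_of_relation {N v u m : ℝ} (hN : 0 < N) (hv : 0 < v) (hu : 0 < u)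
    (h : v * (N + 1 - u) = N * u ^ 2) (hm : m ≤ 1) (hmv : m ≤ v) : m ≤ u := by
  by_contra! hum
  have hd := ratio_lt_of_relation hN hv hu h
  have : u * (N + 1 - u) < N * u ^ 2 := by
    rw [← h]
    exact mul_lt_mul_of_pos_right (hum.trans_le hmv) hd
  nlinarith [mul_pos hu (sub_pos.mpr (hum.trans_le hm))]

theorem ratio_tendsto_one {N : ℝ} (hN : 0 < N) {u : ℕ → ℝ} (hu : ∀ i, 0 < u i)
    (h : ∀ i, u i * (N + 1 - u (i + 1)) = N * u (i + 1) ^ 2) : Tendsto u atTop (𝓝 1) := by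
  set m := min 1 (u 0)
  have hm : 0 < m := lt_min one_pos (hu 0)
  have hmu : ∀ i, m ≤ u i := by
    intro i
    induction i with
    | zero => exact min_le_right _ _
    | succ i ih => exact le_ratio_of_relation hN (hu i) (hu _) (h i) (min_le_left _ _) ih
  have hbound : ∀ i, |u i - 1| ≤ (1 + m)⁻¹ ^ i * |u 0 - 1| := by
    intro i
    induction i with
    | zero => simp
    | succ i ih =>
      rw [pow_succ', mul_assoc, le_inv_mul_iff₀ (by positivity)]
      refine le_trans ?_ ((ratio_contracts hN (hu i) (hu _) (h i)).trans ih)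
      gcongr
      exact hmu _
  have hgeom : Tendsto (fun i : ℕ => (1 + m)⁻¹ ^ i * |u 0 - 1|) atTop (𝓝 0) := by
    simpa using (tendsto_pow_atTop_nhds_zero_of_lt_one (by positivity)
      (inv_lt_one_of_one_lt₀ (lt_add_of_pos_right 1 hm))).mul_const |u 0 - 1|
  rw [tendsto_iff_dist_tendsto_zero]
  exact squeeze_zero (fun _ => dist_nonneg) (fun i => by simpa [Real.dist_eq] using hbound i) hgeom

theorem stmt_0 (n : ℕ) (hn : 1 ≤ n) (t s : ℝ) (ht : 0 < t) (hs : 0 < s) :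
    (∃ (c : ℝ) (x : ℕ → ℝ × ℝ), 0 < c ∧
        (∀ i, 0 < (x i).1 ∧ 0 < (x i).2) ∧
        RicCP n (x 0) = (c * t, c * s) ∧
        ∀ i, RicCP n (x (i + 1)) = x i) ∧
    (∀ (c c' : ℝ) (x x' : ℕ → ℝ × ℝ),
        0 < c → (∀ i, 0 < (x i).1 ∧ 0 < (x i).2) →
          RicCP n (x 0) = (c * t, c * s) → (∀ i, RicCP n (x (i + 1)) = x i) →
        0 < c' → (∀ i, 0 < (x' i).1 ∧ 0 < (x' i).2) →
          RicCP n (x' 0) = (c' * t, c' * s) → (∀ i, RicCP n (x' (i + 1)) = x' i) →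
        c = c' ∧ x = x') ∧
    (∀ (c : ℝ) (x : ℕ → ℝ × ℝ),
        0 < c → (∀ i, 0 < (x i).1 ∧ 0 < (x i).2) →
          RicCP n (x 0) = (c * t, c * s) → (∀ i, RicCP n (x (i + 1)) = x i) →
        Tendsto x atTop (𝓝 ((2 * n : ℝ), (2 * n : ℝ)))) := by
  have hN : (0 : ℝ) < n := by exact_mod_cast hn
  refine ⟨?_, ?_, ?_⟩
  · choose! G hGpos hG using fun v (hv : 0 < v) => exists_ratio_relation hN hv
    have hpos : ∀ i, 0 < G^[i] (t / s) := by
      intro i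
      induction i with
      | zero => exact div_pos ht hs
      | succ i ih => rw [Function.iterate_succ_apply']; exact hGpos _ ih
    have hrel : ∀ i, G^[i] (t / s) * (n + 1 - G^[i + 1] (t / s)) =
        n * G^[i + 1] (t / s) ^ 2 := by
      intro i
      rw [Function.iterate_succ_apply']
      exact hG _ (hpos i)
    have hlt : ∀ i, 0 < n + 1 - G^[i + 1] (t / s) := fun i =>
      ratio_lt_of_relation hN (hpos i) (hpos _) (hrel i)
    have hratio : ∀ i, 2 * n * G^[i + 1] (t / s) ^ 2 / (2 * (n + 1 - G^[i + 1] (t / s))) =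
        G^[i] (t / s) := by
      intro i
      rw [div_eq_iff (mul_pos two_pos (hlt i)).ne']
      linear_combination -2 * hrel i
    refine ⟨2 * n * G^[1] (t / s) ^ 2 / t,
      fun i => (2 * n * G^[i + 2] (t / s) ^ 2, 2 * (n + 1 - G^[i + 2] (t / s))),
      div_pos (mul_pos (by positivity) (pow_pos (hpos 1) 2)) ht,
      fun i => ⟨mul_pos (by positivity) (pow_pos (hpos _) 2), mul_pos two_pos (hlt (i + 1))⟩, ?_, ?_⟩
    · rw [ricCP_eq_ratio]
      simp only [hratio]
      have h0 := hrel 0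
      simp only [Function.iterate_zero, id, zero_add] at h0 ⊢
      ext
      · simp only
        field_simp
      · simp only
        field_simp at h0 ⊢
        linear_combination h0
    · intro i
      rw [ricCP_eq_ratio]
      simp only [hratio]
  · intro c c' x x' hc hx h0 hstep hc' hx' h0' hstep'
    have hratio : ∀ i, (x i).1 / (x i).2 = (x' i).1 / (x' i).2 := by
      intro i
      induction i with
      | zero =>
        have h := ratio_relation_of_ricCP (mul_pos hc hs) h0
        have h' := ratio_relation_of_ricCP (mul_pos hc' hs) h0'
        simp only [mul_div_mul_left _ _ hc.ne', mul_div_mul_left _ _ hc'.ne'] at h h'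
        exact ratio_relation_unique hN (div_pos ht hs) (div_pos (hx 0).1 (hx 0).2)
          (div_pos (hx' 0).1 (hx' 0).2) h h'
      | succ i ih =>
        have h' := ratio_relation_of_ricCP (hx' i).2 (hstep' i)
        rw [← ih] at h'
        exact ratio_relation_unique hN (div_pos (hx i).1 (hx i).2)
          (div_pos (hx _).1 (hx _).2) (div_pos (hx' _).1 (hx' _).2)
          (ratio_relation_of_ricCP (hx i).2 (hstep i)) h'
    constructor
    · have h : (c * t, c * s) = (c' * t, c' * s) := by
        rw [← h0, ← h0', ricCP_eq_ratio, ricCP_eq_ratio, hratio]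
      exact mul_right_cancel₀ ht.ne' (Prod.ext_iff.mp h).1
    · funext i
      rw [← hstep, ← hstep', ricCP_eq_ratio, ricCP_eq_ratio, hratio]
  · intro c x _ hx _ hstep
    have hlim := (tendsto_add_atTop_iff_nat 1).mpr
      (ratio_tendsto_one hN (fun i => div_pos (hx i).1 (hx i).2)
        fun i => ratio_relation_of_ricCP (hx i).2 (hstep i))
    have hx_eq : x = fun i => (2 * n * ((x (i + 1)).1 / (x (i + 1)).2) ^ 2,
        2 * (n + 1 - (x (i + 1)).1 / (x (i + 1)).2)) := by
      funext i
      rw [← ricCP_eq_ratio, hstep]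
    rw [hx_eq]
    have hfst := (hlim.pow 2).const_mul (2 * (n : ℝ))
    have hsnd := (hlim.const_sub ((n : ℝ) + 1)).const_mul 2
    rw [one_pow, mul_one] at hfst
    rw [add_sub_cancel_right] at hsnd
    exact hfst.prodMk_nhds hsnd
end

section
/- Let n ≥ 1 and define the Ricci map Ric(t,s) = (2n t²/s², 2n + 2 − 2t/s) for t,s > 0. Given (t,s) ∈ (0,∞)², there exists a sequence ((t_i,s_i))_{i≤1} of elements of (0,∞)² with (t₁,s₁) = (t,s) and (t_{i−1},s_{i−1}) = Ric(t_i,s_i) for every integer i ≤ 1 if and only if t ≤ s. Moreover, if t < s, then for any such sequence, t_i → 0 and s_i → 2n + 2 as i → −∞. -/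
open Filter Topology

/-- A positive sequence whose terms below `1` are followed by at most their square tends to `0`
if it starts below `1`. -/
lemma tendsto_zero_of_le_sq {r : ℕ → ℝ} (hpos : ∀ k, 0 < r k)
    (hstep : ∀ k, r k ≤ 1 → r (k + 1) ≤ r k ^ 2) (h0 : r 0 < 1) :
    Tendsto r atTop (𝓝 0) := by
  have key : ∀ k, r k ≤ r 0 ∧ r k ≤ r 0 * r 0 ^ k := by
    intro k
    induction k with
    | zero => simp
    | succ k ih =>
      have h1 : r (k + 1) ≤ r k * r 0 := by
        have := hstep k (ih.1.trans h0.le)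
        nlinarith [mul_le_mul_of_nonneg_left ih.1 (hpos k).le]
      have h2 := mul_le_mul_of_nonneg_right ih.2 (hpos 0).le
      refine ⟨?_, ?_⟩
      · nlinarith [mul_le_mul_of_nonneg_right ih.1 (hpos 0).le, hpos 0]
      · calc r (k + 1) ≤ r 0 * r 0 ^ k * r 0 := h1.trans h2
          _ = r 0 * r 0 ^ (k + 1) := by ring
  have hlim : Tendsto (fun k : ℕ => r 0 * r 0 ^ k) atTop (𝓝 0) := by
    simpa using (tendsto_pow_atTop_nhds_zero_of_lt_one (hpos 0).le h0).const_mul (r 0)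
  exact squeeze_zero (fun k => (hpos k).le) (fun k => (key k).2) hlim

/-- A sequence whose terms above `1` are followed by at least their square is unbounded above
if it starts above `1`. -/
lemma exists_lt_of_sq_le {r : ℕ → ℝ} (hstep : ∀ k, 1 ≤ r k → r k ^ 2 ≤ r (k + 1))
    (h0 : 1 < r 0) (B : ℝ) : ∃ k, B < r k := by
  have key : ∀ k, r 0 ≤ r k ∧ r 0 ^ k ≤ r k := by
    intro k
    induction k with
    | zero => simpa using h0.le
    | succ k ih =>
      have h1 : r k * r 0 ≤ r (k + 1) := by
        have := hstep k (h0.le.trans ih.1)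
        nlinarith
      refine ⟨by nlinarith, ?_⟩
      rw [pow_succ]
      exact (mul_le_mul_of_nonneg_right ih.2 (by linarith)).trans h1
  obtain ⟨k, hk⟩ := pow_unbounded_of_one_lt B h0
  exact ⟨k, hk.trans_le (key k).2⟩

lemma RicCP_fst (n : ℕ) (p : ℝ × ℝ) : (RicCP n p).1 = 2 * n * (p.1 / p.2) ^ 2 := by
  simp only [RicCP]
  ring

lemma RicCP_snd (n : ℕ) (p : ℝ × ℝ) : (RicCP n p).2 = 2 * (n + 1 - p.1 / p.2) := by
  simp only [RicCP]
  ring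

/-- The Ricci map acts on the ratio `r = t / s` by `r ↦ n r² / (n + 1 - r)`. -/
lemma RicCP_ratio (n : ℕ) (p : ℝ × ℝ) (h : 0 < (RicCP n p).2) :
    p.1 / p.2 < n + 1 ∧
      (RicCP n p).1 / (RicCP n p).2 * (n + 1 - p.1 / p.2) = n * (p.1 / p.2) ^ 2 := by
  rw [RicCP_snd] at h
  refine ⟨by linarith, ?_⟩
  have : (n : ℝ) + 1 - p.1 / p.2 ≠ 0 := by intro h'; simp [h'] at h
  rw [RicCP_fst, RicCP_snd]
  field_simp

lemma RicCP_ratio_le_sq (n : ℕ) (p : ℝ × ℝ) (h : 0 < (RicCP n p).2) (hp : p.1 / p.2 ≤ 1) :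
    (RicCP n p).1 / (RicCP n p).2 ≤ (p.1 / p.2) ^ 2 := by
  obtain ⟨h1, h2⟩ := RicCP_ratio n p h
  refine le_of_mul_le_mul_right ?_ (sub_pos.2 h1)
  nlinarith [sq_nonneg (p.1 / p.2)]

lemma sq_le_RicCP_ratio (n : ℕ) (p : ℝ × ℝ) (h : 0 < (RicCP n p).2) (hp : 1 ≤ p.1 / p.2) :
    (p.1 / p.2) ^ 2 ≤ (RicCP n p).1 / (RicCP n p).2 := by
  obtain ⟨h1, h2⟩ := RicCP_ratio n p h
  refine le_of_mul_le_mul_right ?_ (sub_pos.2 h1)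
  nlinarith [sq_nonneg (p.1 / p.2)]

/-- The Ricci map preserves the cone `0 < t ≤ s`. -/
lemma RicCP_mem_cone {n : ℕ} (hn : 1 ≤ n) {p : ℝ × ℝ} (h : 0 < p.1 ∧ p.1 ≤ p.2) :
    0 < (RicCP n p).1 ∧ (RicCP n p).1 ≤ (RicCP n p).2 := by
  have hn' : (1 : ℝ) ≤ n := by exact_mod_cast hn
  have hp2 : 0 < p.2 := h.1.trans_le h.2
  have hr : 0 < p.1 / p.2 := div_pos h.1 hp2
  have hr1 : p.1 / p.2 ≤ 1 := (div_le_one hp2).2 h.2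
  rw [RicCP_fst, RicCP_snd]
  refine ⟨by positivity, ?_⟩
  nlinarith [mul_le_mul_of_nonneg_left (pow_le_one₀ (n := 2) hr.le hr1) (by linarith : (0:ℝ) ≤ n)]

theorem stmt_1 (n : ℕ) (hn : 1 ≤ n) (t s : ℝ) (ht : 0 < t) (hs : 0 < s) :
    ((∃ x : ℤ → ℝ × ℝ,
        (∀ i ≤ (1 : ℤ), 0 < (x i).1 ∧ 0 < (x i).2) ∧ x 1 = (t, s) ∧
        ∀ i ≤ (1 : ℤ), x (i - 1) = RicCP n (x i)) ↔ t ≤ s) ∧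
    (t < s → ∀ x : ℤ → ℝ × ℝ,
        (∀ i ≤ (1 : ℤ), 0 < (x i).1 ∧ 0 < (x i).2) → x 1 = (t, s) →
        (∀ i ≤ (1 : ℤ), x (i - 1) = RicCP n (x i)) →
        Tendsto (fun i => (x i).1) atBot (𝓝 (0 : ℝ)) ∧
        Tendsto (fun i => (x i).2) atBot (𝓝 (2 * n + 2 : ℝ))) := by
  have rec_nat : ∀ x : ℤ → ℝ × ℝ, (∀ i ≤ (1 : ℤ), x (i - 1) = RicCP n (x i)) →
      ∀ k : ℕ, x (1 - ((k + 1 : ℕ) : ℤ)) = RicCP n (x (1 - (k : ℤ))) := by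
    intro x hx k
    rw [← hx _ (by omega)]
    congr 1
    push_cast
    ring
  refine ⟨⟨?_, ?_⟩, ?_⟩
  · rintro ⟨x, hpos, h1, hx⟩
    by_contra! hlt
    have hrec := rec_nat x hx
    have hpos2 : ∀ k : ℕ, 0 < (RicCP n (x (1 - (k : ℤ)))).2 := fun k => by
      rw [← hrec]; exact (hpos _ (by omega)).2
    obtain ⟨k, hk⟩ := exists_lt_of_sq_le
      (r := fun k : ℕ => (x (1 - (k : ℤ))).1 / (x (1 - (k : ℤ))).2)
      (fun k h => by
        simp only [hrec]
        exact sq_le_RicCP_ratio n _ (hpos2 k) h)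
      (by simpa [h1] using (one_lt_div hs).2 hlt) (n + 1)
    exact hk.not_gt (RicCP_ratio n _ (hpos2 k)).1
  · intro hts
    have hcone : ∀ k : ℕ, 0 < ((RicCP n)^[k] (t, s)).1 ∧
        ((RicCP n)^[k] (t, s)).1 ≤ ((RicCP n)^[k] (t, s)).2 := by
      intro k
      induction k with
      | zero => exact ⟨ht, hts⟩
      | succ k ih =>
        rw [Function.iterate_succ_apply']
        exact RicCP_mem_cone hn ih
    refine ⟨fun i => (RicCP n)^[(1 - i).toNat] (t, s), fun i _ => ?_, by simp, fun i hi => ?_⟩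
    · exact ⟨(hcone _).1, (hcone _).1.trans_le (hcone _).2⟩
    · have : (1 - (i - 1)).toNat = (1 - i).toNat + 1 := by omega
      simp only [this, Function.iterate_succ_apply']
  · intro hlt x hpos h1 hx
    have hrec := rec_nat x hx
    have hr : Tendsto (fun k : ℕ => (x (1 - (k : ℤ))).1 / (x (1 - (k : ℤ))).2) atTop (𝓝 0) := by
      refine tendsto_zero_of_le_sq
        (fun k => div_pos (hpos _ (by omega)).1 (hpos _ (by omega)).2) (fun k h => ?_)
        (by simpa [h1] using (div_lt_one hs).2 hlt)
      rw [hrec]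
      refine RicCP_ratio_le_sq n _ ?_ h
      rw [← hrec]
      exact (hpos _ (by omega)).2
    have hidx : Tendsto (fun i : ℤ => (-i).toNat) atBot atTop :=
      tendsto_atTop.2 fun b => (eventually_le_atBot (-(b : ℤ))).mono fun i hi => by omega
    have hrZ := hr.comp hidx
    have hxi : ∀ᶠ i : ℤ in atBot, RicCP n (x (1 - ((-i).toNat : ℤ))) = x i := by
      filter_upwards [eventually_le_atBot (0 : ℤ)] with i hi
      rw [← hx _ (by omega)]
      congr 1
      omega
    constructor
    · have h := (hrZ.pow 2).const_mul (2 * n : ℝ)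
      rw [zero_pow two_ne_zero, mul_zero] at h
      refine h.congr' (hxi.mono fun i hi => ?_)
      simp only [← hi, RicCP_fst, Function.comp_apply]
    · have h := (hrZ.const_mul 2).const_sub (2 * n + 2 : ℝ)
      rw [mul_zero, sub_zero] at h
      refine h.congr' (hxi.mono fun i hi => ?_)
      simp only [← hi, RicCP_snd, Function.comp_apply]
      ring
end

section
/- Let n ≥ 1 and define the Ricci map Ric(t,s) = (2 + 4n t²/s², 4n + 8 − 6t/s) for t,s > 0. Given (t,s) ∈ (0,∞)², there exist a constant c > 0 and a sequence ((t_i,s_i))_{i≥1} of elements of (0,∞)² with Ric(t₁,s₁) = (c t, c s) and Ric(t_{i+1},s_{i+1}) = (t_i,s_i) for all i ≥ 1 if and only if t/s ≥ 1/(2n+3). When it exists, the pair of the constant c and the sequence is unique. Moreover, if t/s > 1/(2n+3), then (t_i,s_i) converges to (4n+2, 4n+2) as i → ∞. -/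
open Filter Topology

/-- The Ricci map for the `Sp(n+1)Sp(1)`-invariant metrics `g_{t,s}` on `S^{4n+3}`:
`Ric(t,s) = (2 + 4n t²/s², 4n + 8 − 6t/s)`. -/
noncomputable def RicHP (n : ℕ) (p : ℝ × ℝ) : ℝ × ℝ :=
  (2 + 4 * n * p.1 ^ 2 / p.2 ^ 2, 4 * n + 8 - 6 * p.1 / p.2)

/-- `u` is an admissible ratio of a metric whose Ricci tensor has ratio `v`. -/
def RatioStep (m u v : ℝ) : Prop :=
  0 < u ∧ 0 < v ∧ 0 < 4 * m + 8 - 6 * u ∧ v * (4 * m + 8 - 6 * u) = 2 + 4 * m * u ^ 2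

namespace RatioStep

variable {m u v : ℝ}

theorem unique {u' : ℝ} (hm : 0 < m) (h : RatioStep m u v) (h' : RatioStep m u' v) :
    u = u' := by
  obtain ⟨hu, hv, -, h⟩ := h
  obtain ⟨hu', -, -, h'⟩ := h'
  have hpos : 0 < 4 * m * (u + u') + 6 * v := by positivity
  have hzero : (u - u') * (4 * m * (u + u') + 6 * v) = 0 := by linear_combination h' - h
  rcases mul_eq_zero.1 hzero with h0 | h0
  · linarith
  · exact absurd h0 hpos.ne'

theorem exists_of_le (hm : 0 < m) (hv : 1 / (2 * m + 3) ≤ v) : ∃ u, RatioStep m u v := by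
  have ha : 0 < 1 / (2 * m + 3) := by positivity
  have hv0 : 0 < v := ha.trans_le hv
  have hlt : 1 / (2 * m + 4) < v := by
    refine lt_of_lt_of_le ?_ hv
    apply one_div_lt_one_div_of_lt <;> linarith
  have hv1 : 1 < v * (2 * m + 4) := (div_lt_iff₀ (by positivity)).1 hlt
  have hcont : Continuous fun u : ℝ => 4 * m * u ^ 2 + 6 * v * u + 2 - v * (4 * m + 8) := by
    fun_prop
  obtain ⟨u, ⟨hu, -⟩, h⟩ := intermediate_value_Icc (a := 0) (b := (4 * m + 8) / 6)
    (by positivity) hcont.continuousOn (show (0 : ℝ) ∈ _ from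
      ⟨by linarith, by
        have : 0 < m * ((4 * m + 8) / 6) ^ 2 := by positivity
        linarith⟩)
  dsimp only at h
  have hu0 : u ≠ 0 := by
    rintro rfl
    linarith
  have heq : v * (4 * m + 8 - 6 * u) = 2 + 4 * m * u ^ 2 := by linarith
  refine ⟨u, lt_of_le_of_ne hu hu0.symm, hv0, ?_, heq⟩
  exact pos_of_mul_pos_right (heq ▸ by positivity) hv0.le

theorem sub_mul (h : RatioStep m u v) :
    (v - u) * (4 * m + 8 - 6 * u) = 2 * ((u - 1) * ((2 * m + 3) * u - 1)) := by
  linear_combination h.2.2.2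

/-- The Ricci map preserves the order of the ratio relative to a fixed ratio `b`. -/
theorem sub_fixed_mul {b : ℝ} (h : RatioStep m u v) (hb : (b - 1) * ((2 * m + 3) * b - 1) = 0) :
    (v - b) * (4 * m + 8 - 6 * u) = (u - b) * (4 * m * (u + b) + 6 * b) := by
  linear_combination h.2.2.2 + 2 * hb

theorem le_iff {b : ℝ} (hm : 0 < m) (hb0 : 0 < b) (h : RatioStep m u v)
    (hb : (b - 1) * ((2 * m + 3) * b - 1) = 0) : b ≤ v ↔ b ≤ u := by
  have hu := h.1
  have hD := h.2.2.1
  have hE : 0 < 4 * m * (u + b) + 6 * b := by positivity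
  rw [← sub_nonneg, ← mul_nonneg_iff_of_pos_right hD, h.sub_fixed_mul hb,
    mul_nonneg_iff_of_pos_right hE, sub_nonneg]

theorem le_iff_mul_nonneg (h : RatioStep m u v) :
    u ≤ v ↔ 0 ≤ (u - 1) * ((2 * m + 3) * u - 1) := by
  rw [← sub_nonneg, ← mul_nonneg_iff_of_pos_right h.2.2.1, h.sub_mul]
  exact mul_nonneg_iff_of_pos_left two_pos

theorem ge_iff_mul_nonpos (h : RatioStep m u v) :
    v ≤ u ↔ (u - 1) * ((2 * m + 3) * u - 1) ≤ 0 := by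
  have hD := h.2.2.1
  have hs := h.sub_mul
  constructor
  · intro hvu
    have := mul_nonneg (sub_nonneg.2 hvu) hD.le
    linarith
  · intro hle
    by_contra! hlt
    have := mul_pos (sub_pos.2 hlt) hD
    linarith

end RatioStep

section Sequence

variable {m : ℝ} {w : ℕ → ℝ}

theorem limit_ratio_fixed {L : ℝ} (hw : ∀ i, RatioStep m (w (i + 1)) (w i))
    (hL : Tendsto w atTop (𝓝 L)) : (L - 1) * ((2 * m + 3) * L - 1) = 0 := by
  have hL' : Tendsto (fun i => w (i + 1)) atTop (𝓝 L) := hL.comp (tendsto_add_atTop_nat 1)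
  have h1 := hL.mul (hL'.const_mul 6 |>.const_sub (4 * m + 8))
  have h2 := (hL'.pow 2).const_mul (4 * m) |>.const_add 2
  have := tendsto_nhds_unique h1 (h2.congr fun i => (hw i).2.2.2.symm)
  linear_combination -this / 2

theorem inv_fixed_eq_zero (hm : 0 < m) :
    (1 / (2 * m + 3) - 1) * ((2 * m + 3) * (1 / (2 * m + 3)) - 1) = 0 := by
  rw [mul_one_div_cancel (by positivity), sub_self, mul_zero]

theorem inv_fixed_lt_one (hm : 0 < m) : 1 / (2 * m + 3) < 1 := by
  rw [div_lt_one (by positivity)]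
  linarith

theorem le_ratio_iff {b : ℝ} (hm : 0 < m) (hw : ∀ i, RatioStep m (w (i + 1)) (w i)) (hb0 : 0 < b)
    (hb : (b - 1) * ((2 * m + 3) * b - 1) = 0) (i : ℕ) : b ≤ w i ↔ b ≤ w 0 := by
  induction i with
  | zero => rfl
  | succ i ih => rw [← ih, (hw i).le_iff hm hb0 hb]

theorem le_initial_ratio (hm : 0 < m) (hw : ∀ i, RatioStep m (w (i + 1)) (w i)) :
    1 / (2 * m + 3) ≤ w 0 := by
  by_contra! h0
  have ha := inv_fixed_eq_zero hm
  have hlt1 := inv_fixed_lt_one hm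
  have hlt : ∀ i, w i < 1 / (2 * m + 3) := fun i => by
    rw [← not_le, le_ratio_iff hm hw (by positivity) ha, not_le]
    exact h0
  have hanti : Antitone w := antitone_nat_of_succ_le fun i => by
    rw [(hw i).le_iff_mul_nonneg]
    have hi := hlt (i + 1)
    have hi' := (lt_div_iff₀ (by positivity)).1 hi
    exact mul_nonneg_of_nonpos_of_nonpos (by linarith) (by linarith)
  have hbdd : BddBelow (Set.range w) := ⟨0, by rintro _ ⟨i, rfl⟩; exact (hw i).2.1.le⟩
  have hL := tendsto_atTop_ciInf hanti hbdd
  have hle : (⨅ i, w i) < 1 / (2 * m + 3) := (ciInf_le hbdd 0).trans_lt h0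
  have hle' := (lt_div_iff₀ (by positivity)).1 hle
  rcases mul_eq_zero.1 (limit_ratio_fixed hw hL) with h | h <;> linarith

theorem tendsto_ratio_one (hm : 0 < m) (hw : ∀ i, RatioStep m (w (i + 1)) (w i))
    (h0 : 1 / (2 * m + 3) < w 0) : Tendsto w atTop (𝓝 1) := by
  have hlt1 := inv_fixed_lt_one hm
  have key : ∀ L, Tendsto w atTop (𝓝 L) → 1 / (2 * m + 3) < L → Tendsto w atTop (𝓝 1) := by
    intro L hL hlt
    have hlt' := (div_lt_iff₀ (by positivity)).1 hlt
    rcases mul_eq_zero.1 (limit_ratio_fixed hw hL) with h | h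
    · rwa [show (1 : ℝ) = L by linarith]
    · linarith
  rcases le_or_gt 1 (w 0) with h1 | h1
  · have hge : ∀ i, 1 ≤ w i := fun i => (le_ratio_iff hm hw one_pos (by ring) i).2 h1
    have hanti : Antitone w := antitone_nat_of_succ_le fun i => by
      rw [(hw i).le_iff_mul_nonneg]
      have hi := hge (i + 1)
      have := mul_pos hm (one_pos.trans_le hi)
      exact mul_nonneg (by linarith) (by linarith)
    have hbdd : BddBelow (Set.range w) := ⟨1, by rintro _ ⟨i, rfl⟩; exact hge i⟩
    exact key _ (tendsto_atTop_ciInf hanti hbdd) (hlt1.trans_le (le_ciInf hge))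
  · have hlt : ∀ i, w i < 1 := fun i => by
      rw [← not_le, le_ratio_iff hm hw one_pos (by ring), not_le]
      exact h1
    have hge : ∀ i, 1 / (2 * m + 3) ≤ w i := fun i =>
      (le_ratio_iff hm hw (by positivity) (inv_fixed_eq_zero hm) i).2 h0.le
    have hmono : Monotone w := monotone_nat_of_le_succ fun i => by
      rw [(hw i).ge_iff_mul_nonpos]
      have hi := (div_le_iff₀ (by positivity)).1 (hge (i + 1))
      exact mul_nonpos_of_nonpos_of_nonneg (by linarith [hlt (i + 1)]) (by linarith)
    have hbdd : BddAbove (Set.range w) := ⟨1, by rintro _ ⟨i, rfl⟩; exact (hlt i).le⟩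
    exact key _ (tendsto_atTop_ciSup hmono hbdd) (h0.trans_le (le_ciSup hbdd 0))

theorem ratio_eq {w' : ℕ → ℝ} (hm : 0 < m) (hw : ∀ i, RatioStep m (w (i + 1)) (w i))
    (hw' : ∀ i, RatioStep m (w' (i + 1)) (w' i)) (h0 : w 0 = w' 0) : w = w' := by
  funext i
  induction i with
  | zero => exact h0
  | succ i ih => exact (hw i).unique hm (ih ▸ hw' i)

theorem exists_ratio_sequence {v : ℝ} (hm : 0 < m) (hv : 1 / (2 * m + 3) ≤ v) :
    ∃ w : ℕ → ℝ, w 0 = v ∧ ∀ i, RatioStep m (w (i + 1)) (w i) := by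
  have hstep : ∀ v : {v : ℝ // 1 / (2 * m + 3) ≤ v},
      ∃ u : {v : ℝ // 1 / (2 * m + 3) ≤ v}, RatioStep m u v := by
    rintro ⟨v, hv⟩
    obtain ⟨u, hu⟩ := RatioStep.exists_of_le hm hv
    exact ⟨⟨u, (hu.le_iff hm (by positivity) (inv_fixed_eq_zero hm)).1 hv⟩, hu⟩
  choose f hf using hstep
  refine ⟨fun i => (f^[i] ⟨v, hv⟩ : {v : ℝ // 1 / (2 * m + 3) ≤ v}), rfl, fun i => ?_⟩
  dsimp only
  rw [Function.iterate_succ_apply']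
  exact hf _

end Sequence

theorem RicHP_eq_ratio (n : ℕ) (p : ℝ × ℝ) :
    RicHP n p = (2 + 4 * n * (p.1 / p.2) ^ 2, 4 * n + 8 - 6 * (p.1 / p.2)) := by
  simp only [RicHP, div_pow, mul_div_assoc]

theorem ratioStep_of_RicHP_eq {n : ℕ} {p : ℝ × ℝ} {a b : ℝ} (hp : 0 < p.1 ∧ 0 < p.2)
    (ha : 0 < a) (hb : 0 < b) (h : RicHP n p = (a, b)) : RatioStep n (p.1 / p.2) (a / b) := by
  rw [RicHP_eq_ratio, Prod.mk.injEq] at h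
  refine ⟨div_pos hp.1 hp.2, div_pos ha hb, h.2 ▸ hb, ?_⟩
  rw [h.1, h.2, div_mul_cancel₀ _ hb.ne']

/-- The sequence of ratios of iterated Ricci preimages of a multiple of `(t, s)`. -/
theorem exists_ratio_of_iterated_preimage {n : ℕ} {t s c : ℝ} {x : ℕ → ℝ × ℝ} (ht : 0 < t)
    (hs : 0 < s) (hc : 0 < c) (hx : ∀ i, 0 < (x i).1 ∧ 0 < (x i).2)
    (h0 : RicHP n (x 0) = (c * t, c * s)) (h : ∀ i, RicHP n (x (i + 1)) = x i) :
    ∃ w : ℕ → ℝ, w 0 = t / s ∧ (∀ i, RatioStep n (w (i + 1)) (w i)) ∧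
      c * s = 4 * n + 8 - 6 * w 1 ∧
      ∀ i, x i = (2 + 4 * n * w (i + 2) ^ 2, 4 * n + 8 - 6 * w (i + 2)) := by
  refine ⟨fun i => Nat.casesOn i (t / s) fun j => (x j).1 / (x j).2, rfl, ?_, ?_, fun i => ?_⟩
  · rintro (_ | i)
    · have := ratioStep_of_RicHP_eq (hx 0) (mul_pos hc ht) (mul_pos hc hs) h0
      rwa [mul_div_mul_left _ _ hc.ne'] at this
    · exact ratioStep_of_RicHP_eq (hx (i + 1)) (hx i).1 (hx i).2 (h i)
  · rw [RicHP_eq_ratio, Prod.mk.injEq] at h0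
    exact h0.2.symm
  · rw [← h i, RicHP_eq_ratio]

theorem stmt_2 (n : ℕ) (hn : 1 ≤ n) (t s : ℝ) (ht : 0 < t) (hs : 0 < s) :
    ((∃ (c : ℝ) (x : ℕ → ℝ × ℝ), 0 < c ∧
        (∀ i, 0 < (x i).1 ∧ 0 < (x i).2) ∧
        RicHP n (x 0) = (c * t, c * s) ∧
        ∀ i, RicHP n (x (i + 1)) = x i) ↔ 1 / (2 * n + 3) ≤ t / s) ∧
    (∀ (c c' : ℝ) (x x' : ℕ → ℝ × ℝ),
        0 < c → (∀ i, 0 < (x i).1 ∧ 0 < (x i).2) →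
          RicHP n (x 0) = (c * t, c * s) → (∀ i, RicHP n (x (i + 1)) = x i) →
        0 < c' → (∀ i, 0 < (x' i).1 ∧ 0 < (x' i).2) →
          RicHP n (x' 0) = (c' * t, c' * s) → (∀ i, RicHP n (x' (i + 1)) = x' i) →
        c = c' ∧ x = x') ∧
    (1 / (2 * n + 3) < t / s →
      ∀ (c : ℝ) (x : ℕ → ℝ × ℝ),
        0 < c → (∀ i, 0 < (x i).1 ∧ 0 < (x i).2) →
          RicHP n (x 0) = (c * t, c * s) → (∀ i, RicHP n (x (i + 1)) = x i) →
        Tendsto x atTop (𝓝 ((4 * n + 2 : ℝ), (4 * n + 2 : ℝ)))) := by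
  have hm : (0 : ℝ) < n := by exact_mod_cast hn
  refine ⟨⟨?_, fun hts => ?_⟩, ?_, ?_⟩
  · rintro ⟨c, x, hc, hx, h0, h⟩
    obtain ⟨w, hw0, hw, -, -⟩ := exists_ratio_of_iterated_preimage ht hs hc hx h0 h
    exact hw0 ▸ le_initial_ratio hm hw
  · obtain ⟨w, hw0, hw⟩ := exists_ratio_sequence hm hts
    have hratio : ∀ i, (2 + 4 * n * w (i + 1) ^ 2) / (4 * n + 8 - 6 * w (i + 1)) = w i := fun i =>
      (eq_div_of_mul_eq (hw i).2.2.1.ne' (hw i).2.2.2).symm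
    refine ⟨(4 * n + 8 - 6 * w 1) / s,
      fun i => (2 + 4 * n * w (i + 2) ^ 2, 4 * n + 8 - 6 * w (i + 2)),
      div_pos (hw 0).2.2.1 hs, fun i => ⟨by positivity, (hw (i + 1)).2.2.1⟩, ?_, fun i => ?_⟩
    · rw [RicHP_eq_ratio, Prod.mk.injEq]
      dsimp only
      have h1 := (hw 0).2.2.2
      rw [hw0] at h1
      rw [hratio (0 + 1), div_mul_cancel₀ _ hs.ne', ← h1]
      exact ⟨by ring, rfl⟩
    · rw [RicHP_eq_ratio]
      dsimp only
      rw [hratio (i + 1 + 1)]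
  · intro c c' x x' hc hx h0 h hc' hx' h0' h'
    obtain ⟨w, hw0, hw, hcs, hxw⟩ := exists_ratio_of_iterated_preimage ht hs hc hx h0 h
    obtain ⟨w', hw0', hw', hcs', hxw'⟩ :=
      exists_ratio_of_iterated_preimage ht hs hc' hx' h0' h'
    obtain rfl := ratio_eq hm hw hw' (hw0.trans hw0'.symm)
    exact ⟨mul_right_cancel₀ hs.ne' (hcs.trans hcs'.symm),
      funext fun i => (hxw i).trans (hxw' i).symm⟩
  · intro hts c x hc hx h0 h
    obtain ⟨w, hw0, hw, -, hxw⟩ := exists_ratio_of_iterated_preimage ht hs hc hx h0 h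
    have hlim := (tendsto_ratio_one hm hw (hw0 ▸ hts)).comp (tendsto_add_atTop_nat 2)
    have h1 := (hlim.pow 2).const_mul (4 * (n : ℝ)) |>.const_add 2
    have h2 := hlim.const_mul 6 |>.const_sub (4 * (n : ℝ) + 8)
    rw [show 2 + 4 * (n : ℝ) * 1 ^ 2 = 4 * n + 2 by ring] at h1
    rw [show 4 * (n : ℝ) + 8 - 6 * 1 = 4 * n + 2 by ring] at h2
    exact (h1.prodMk_nhds h2).congr fun i => (hxw i).symm
end

section
/- Define the Ricci map Ric(t,s) = (6 + 8t²/s², 28 − 14t/s) for t,s > 0. Given (t,s) ∈ (0,∞)², there exist a constant c > 0 and a sequence ((t_i,s_i))_{i≥1} of elements of (0,∞)² with Ric(t₁,s₁) = (c t, c s) and Ric(t_{i+1},s_{i+1}) = (t_i,s_i) for all i ≥ 1 if and only if t/s ≥ 3/11. When it exists, the pair of the constant c and the sequence is unique. Moreover, if t/s > 3/11, then (t_i,s_i) converges to (14, 14) as i → ∞. -/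
open Filter Topology

/-- The Ricci map for the `Spin(9)`-invariant metrics `g_{t,s}` on `S^{15}`:
`Ric(t,s) = (6 + 8t²/s², 28 − 14t/s)`. -/
noncomputable def RicS15 (p : ℝ × ℝ) : ℝ × ℝ :=
  (6 + 8 * p.1 ^ 2 / p.2 ^ 2, 28 - 14 * p.1 / p.2)

/-- The Spin(9)-invariant metrics with ratio `u` of vertical to horizontal scale have Ricci
curvature with positive components in the ratio `v`. -/
def RicciRatio (v u : ℝ) : Prop :=
  0 < u ∧ u < 2 ∧ 3 + 4 * u ^ 2 = 7 * v * (2 - u)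

namespace RicciRatio

variable {v u u' a : ℝ}

lemma left_pos (h : RicciRatio v u) : 0 < v := by
  obtain ⟨_, h2, e⟩ := h
  by_contra hv
  nlinarith [sq_nonneg u]

lemma right_unique (h : RicciRatio v u) (h' : RicciRatio v u') : u = u' := by
  have hv := h.left_pos
  obtain ⟨h1, _, e⟩ := h
  obtain ⟨h1', _, e'⟩ := h'
  have : (u - u') * (4 * (u + u') + 7 * v) = 0 := by linarith
  rcases mul_eq_zero.1 this with h | h
  · linarith
  · linarith

lemma exists_right (hv : 3 / 11 ≤ v) : ∃ u, 3 / 11 ≤ u ∧ RicciRatio v u := by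
  have hc : ContinuousOn (fun u : ℝ => 3 + 4 * u ^ 2 - 7 * v * (2 - u)) (Set.Icc (3 / 11) 2) := by
    fun_prop
  obtain ⟨u, ⟨h1, h2⟩, hu⟩ := intermediate_value_Icc (by norm_num) hc
    (show (0 : ℝ) ∈ Set.Icc _ _ from ⟨by norm_num; linarith, by norm_num⟩)
  have hu : 3 + 4 * u ^ 2 - 7 * v * (2 - u) = 0 := hu
  refine ⟨u, h1, by linarith, lt_of_le_of_ne h2 ?_, by linarith⟩
  rintro rfl
  norm_num at hu

lemma le_right (h : RicciRatio v u) (ha : 3 / 11 ≤ a) (ha1 : a ≤ 1) (hav : a ≤ v) : a ≤ u := by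
  obtain ⟨h1, h2, e⟩ := h
  by_contra! hlt
  have e1 : 0 ≤ (v - a) * (2 - u) := mul_nonneg (by linarith) (by linarith)
  have e2 : 0 < a * (a - u) := mul_pos (by linarith) (by linarith)
  have e3 : 0 < (a - u) * (a + u) := mul_pos (by linarith) (by linarith)
  have e4 : 0 ≤ (11 * a - 3) * (1 - a) := mul_nonneg (by linarith) (by linarith)
  linarith

lemma abs_sub_one_le (h : RicciRatio v u) (ha : 3 / 11 ≤ a) (hau : a ≤ u) :
    |u - 1| ≤ 7 * (2 - a) / (4 * a + 11) * |v - 1| := by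
  obtain ⟨h1, h2, e⟩ := h
  have hu : u - 1 = 7 * (2 - u) / (4 * u + 11) * (v - 1) := by
    field_simp
    linarith
  rw [hu, abs_mul, abs_of_nonneg (div_nonneg (by linarith) (by linarith))]
  gcongr
  linarith

lemma two_mul_sub_le (h : RicciRatio v u) (hv : v < 3 / 11) :
    2 * (3 / 11 - v) ≤ 3 / 11 - u := by
  obtain ⟨h1, h2, e⟩ := h
  have e1 : (3 / 11 - u) * (4 * u + 3) = (3 / 11 - v) * (7 * (2 - u)) := by linarith
  have hu : 0 < 3 / 11 - u := by
    have : 0 < (3 / 11 - v) * (7 * (2 - u)) := mul_pos (by linarith) (by linarith)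
    rw [← e1] at this
    exact pos_of_mul_pos_left this (by linarith)
  have e2 : 0 ≤ (3 / 11 - v) * (7 * (2 - u) - 2 * (4 * u + 3)) :=
    mul_nonneg (by linarith) (by linarith)
  refine le_of_mul_le_mul_right ?_ (show 0 < 4 * u + 3 by linarith)
  linarith

variable {r r' : ℕ → ℝ}

lemma seq_unique (h0 : r 0 = r' 0) (h : ∀ n, RicciRatio (r n) (r (n + 1)))
    (h' : ∀ n, RicciRatio (r' n) (r' (n + 1))) : r = r' := by
  funext n
  induction n with
  | zero => exact h0
  | succ n ih => exact (h n).right_unique (ih ▸ h' n)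

lemma exists_seq (hv : 3 / 11 ≤ v) :
    ∃ r : ℕ → ℝ, r 0 = v ∧ ∀ n, RicciRatio (r n) (r (n + 1)) := by
  choose! g hg hgr using fun (w : ℝ) (hw : 3 / 11 ≤ w) => exists_right hw
  refine ⟨fun n => g^[n] v, rfl, fun n => ?_⟩
  have hn : 3 / 11 ≤ g^[n] v := by
    induction n with
    | zero => exact hv
    | succ n ih => rw [Function.iterate_succ_apply']; exact hg _ ih
  simp only [Function.iterate_succ_apply']
  exact hgr _ hn

lemma le_zero_of_seq (h : ∀ n, RicciRatio (r n) (r (n + 1))) : 3 / 11 ≤ r 0 := by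
  by_contra! h0
  have key : ∀ n, r n < 3 / 11 ∧ 2 ^ n * (3 / 11 - r 0) ≤ 3 / 11 - r n := by
    intro n
    induction n with
    | zero => simp [h0]
    | succ n ih =>
      have := (h n).two_mul_sub_le ih.1
      refine ⟨by linarith [ih.1], ?_⟩
      rw [pow_succ]
      linarith [ih.2]
  obtain ⟨n, hn⟩ := pow_unbounded_of_one_lt ((3 / 11) / (3 / 11 - r 0)) (one_lt_two (α := ℝ))
  rw [div_lt_iff₀ (by linarith)] at hn
  linarith [(key n).2, (h n).left_pos]

lemma tendsto_seq (h : ∀ n, RicciRatio (r n) (r (n + 1))) (h0 : 3 / 11 < r 0) :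
    Tendsto r atTop (𝓝 1) := by
  set a := min (r 0) 1
  have ha : 3 / 11 < a := lt_min h0 (by norm_num)
  have ha1 : a ≤ 1 := min_le_right _ _
  have har : ∀ n, a ≤ r n := by
    intro n
    induction n with
    | zero => exact min_le_left _ _
    | succ n ih => exact (h n).le_right ha.le ha1 ih
  set q := 7 * (2 - a) / (4 * a + 11)
  have hq0 : 0 ≤ q := div_nonneg (by linarith) (by linarith)
  have hq1 : q < 1 := by
    rw [div_lt_one (by linarith)]
    linarith
  have hb : ∀ n, |r n - 1| ≤ q ^ n * |r 0 - 1| := by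
    intro n
    induction n with
    | zero => simp
    | succ n ih =>
      calc |r (n + 1) - 1| ≤ q * |r n - 1| := (h n).abs_sub_one_le ha.le (har _)
        _ ≤ q * (q ^ n * |r 0 - 1|) := by gcongr
        _ = q ^ (n + 1) * |r 0 - 1| := by ring
  rw [tendsto_iff_norm_sub_tendsto_zero]
  refine squeeze_zero (fun _ => norm_nonneg _) hb ?_
  simpa using (tendsto_pow_atTop_nhds_zero_of_lt_one hq0 hq1).mul_const |r 0 - 1|

end RicciRatio

lemma RicS15_eq (p : ℝ × ℝ) :
    RicS15 p = (6 + 8 * (p.1 / p.2) ^ 2, 28 - 14 * (p.1 / p.2)) := by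
  simp only [RicS15, div_pow, mul_div_assoc]

lemma ricciRatio_of_RicS15_eq {p : ℝ × ℝ} {a b : ℝ} (h1 : 0 < p.1) (h2 : 0 < p.2) (hb : 0 < b)
    (h : RicS15 p = (a, b)) : RicciRatio (a / b) (p.1 / p.2) := by
  rw [RicS15_eq, Prod.mk.injEq] at h
  refine ⟨div_pos h1 h2, by linarith, ?_⟩
  obtain ⟨ha, hb'⟩ := h
  have : 2 - p.1 / p.2 = b / 14 := by linarith
  rw [this]
  field_simp at ha ⊢
  linarith

lemma exists_ratio_seq_of_RicS15 {t s c : ℝ} {x : ℕ → ℝ × ℝ} (hs : 0 < s) (hc : 0 < c)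
    (hx : ∀ i, 0 < (x i).1 ∧ 0 < (x i).2) (h0 : RicS15 (x 0) = (c * t, c * s))
    (h : ∀ i, RicS15 (x (i + 1)) = x i) :
    ∃ r : ℕ → ℝ, r 0 = t / s ∧ (∀ n, RicciRatio (r n) (r (n + 1))) ∧
      c = (28 - 14 * r 1) / s ∧
      x = fun n => (6 + 8 * r (n + 2) ^ 2, 28 - 14 * r (n + 2)) := by
  refine ⟨fun n => Nat.casesOn n (t / s) fun m => (x m).1 / (x m).2, rfl, fun n => ?_, ?_, ?_⟩
  · cases n with
    | zero =>
      have := ricciRatio_of_RicS15_eq (hx 0).1 (hx 0).2 (mul_pos hc hs) h0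
      rwa [mul_div_mul_left _ _ hc.ne'] at this
    | succ n => exact ricciRatio_of_RicS15_eq (hx (n + 1)).1 (hx (n + 1)).2 (hx n).2 (h n)
  · rw [RicS15_eq, Prod.mk.injEq] at h0
    rw [eq_div_iff hs.ne']
    exact h0.2.symm
  · funext n
    rw [← h n, RicS15_eq]

lemma exists_RicS15_seq_of_ratio {t s : ℝ} {r : ℕ → ℝ} (hs : 0 < s) (h0 : r 0 = t / s)
    (h : ∀ n, RicciRatio (r n) (r (n + 1))) :
    ∃ (c : ℝ) (x : ℕ → ℝ × ℝ), 0 < c ∧ (∀ i, 0 < (x i).1 ∧ 0 < (x i).2) ∧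
      RicS15 (x 0) = (c * t, c * s) ∧ ∀ i, RicS15 (x (i + 1)) = x i := by
  have hratio : ∀ n, (6 + 8 * r (n + 1) ^ 2) / (28 - 14 * r (n + 1)) = r n := by
    intro n
    obtain ⟨_, h2, e⟩ := h n
    rw [div_eq_iff (by linarith)]
    linarith
  refine ⟨(28 - 14 * r 1) / s, fun n => (6 + 8 * r (n + 2) ^ 2, 28 - 14 * r (n + 2)),
    div_pos (by linarith [(h 0).2.1]) hs,
    fun n => ⟨by positivity, by linarith [(h (n + 1)).2.1]⟩, ?_, fun n => ?_⟩
  · rw [RicS15_eq, Prod.mk.injEq]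
    simp only [hratio]
    refine ⟨?_, by field_simp⟩
    rw [div_mul_eq_mul_div, mul_div_assoc, ← h0]
    linarith [(h 0).2.2]
  · simp only [RicS15_eq, hratio]

theorem stmt_4 (t s : ℝ) (ht : 0 < t) (hs : 0 < s) :
    ((∃ (c : ℝ) (x : ℕ → ℝ × ℝ), 0 < c ∧
        (∀ i, 0 < (x i).1 ∧ 0 < (x i).2) ∧
        RicS15 (x 0) = (c * t, c * s) ∧
        ∀ i, RicS15 (x (i + 1)) = x i) ↔ 3 / 11 ≤ t / s) ∧
    (∀ (c c' : ℝ) (x x' : ℕ → ℝ × ℝ),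
        0 < c → (∀ i, 0 < (x i).1 ∧ 0 < (x i).2) →
          RicS15 (x 0) = (c * t, c * s) → (∀ i, RicS15 (x (i + 1)) = x i) →
        0 < c' → (∀ i, 0 < (x' i).1 ∧ 0 < (x' i).2) →
          RicS15 (x' 0) = (c' * t, c' * s) → (∀ i, RicS15 (x' (i + 1)) = x' i) →
        c = c' ∧ x = x') ∧
    (3 / 11 < t / s →
      ∀ (c : ℝ) (x : ℕ → ℝ × ℝ),
        0 < c → (∀ i, 0 < (x i).1 ∧ 0 < (x i).2) →
          RicS15 (x 0) = (c * t, c * s) → (∀ i, RicS15 (x (i + 1)) = x i) →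
        Tendsto x atTop (𝓝 ((14 : ℝ), (14 : ℝ)))) := by
  refine ⟨⟨?_, fun h => ?_⟩, ?_, ?_⟩
  · rintro ⟨c, x, hc, hx, h0, h⟩
    obtain ⟨r, hr0, hr, -, -⟩ := exists_ratio_seq_of_RicS15 hs hc hx h0 h
    exact hr0 ▸ RicciRatio.le_zero_of_seq hr
  · obtain ⟨r, hr0, hr⟩ := RicciRatio.exists_seq h
    exact exists_RicS15_seq_of_ratio hs hr0 hr
  · intro c c' x x' hc hx h0 h hc' hx' h0' h'
    obtain ⟨r, hr0, hr, rfl, rfl⟩ := exists_ratio_seq_of_RicS15 hs hc hx h0 h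
    obtain ⟨r', hr0', hr', rfl, rfl⟩ := exists_ratio_seq_of_RicS15 hs hc' hx' h0' h'
    obtain rfl := RicciRatio.seq_unique (hr0.trans hr0'.symm) hr hr'
    exact ⟨rfl, rfl⟩
  · intro hts c x hc hx h0 h
    obtain ⟨r, hr0, hr, -, rfl⟩ := exists_ratio_seq_of_RicS15 hs hc hx h0 h
    have hlim := (tendsto_add_atTop_iff_nat 2).2 (RicciRatio.tendsto_seq hr (hr0 ▸ hts))
    have h1 := ((hlim.pow 2).const_mul 8).const_add 6
    have h2 := (hlim.const_mul 14).const_sub 28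
    norm_num at h1 h2
    exact h1.prodMk_nhds h2
end

section
/- (Hamilton) For every T = (T₁,T₂,T₃) ∈ (0,∞)³ there exist x = (x₁,x₂,x₃) ∈ (0,∞)³ and a constant c > 0 such that R(x)_i = c T_i for i = 1,2,3. Moreover, the solution is unique up to scaling: if x' ∈ (0,∞)³ and c' > 0 also satisfy R(x')_i = c' T_i for all i, then c' = c and x' = λ x for some λ > 0. -/
/-- The Ricci map for left-invariant metrics on `SU(2)`, diagonal with eigenvalues
`x : Fin 3 → ℝ`: `R(x)_i = 2(x_i² − (x_{i+1} − x_{i+2})²)/(x_{i+1} x_{i+2})`, indices mod 3. -/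
noncomputable def RicSU2 (x : Fin 3 → ℝ) : Fin 3 → ℝ :=
  fun i => 2 * (x i ^ 2 - (x (i + 1) - x (i + 2)) ^ 2) / (x (i + 1) * x (i + 2))

/-- The Ricci curvature expressed in the reciprocals of the quantities `x_j + x_k - x_i`. -/
lemma ricSU2_coord {a b d : ℝ} (ha : 0 < a) (hb : 0 < b) (hd : 0 < d) :
    2 * ((1 / b + 1 / d) ^ 2 - ((1 / d + 1 / a) - (1 / a + 1 / b)) ^ 2) /
      ((1 / d + 1 / a) * (1 / a + 1 / b)) = 8 * a ^ 2 / ((a + b) * (a + d)) := by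
  field_simp
  ring

lemma ricSU2_smul {k : ℝ} (hk : 0 < k) (x : Fin 3 → ℝ) :
    RicSU2 (fun i => k * x i) = RicSU2 x := by
  funext i
  have h : ∀ a b d : ℝ, 2 * ((k * a) ^ 2 - (k * b - k * d) ^ 2) / (k * b * (k * d)) =
      2 * (a ^ 2 - (b - d) ^ 2) / (b * d) := by
    intro a b d
    rw [show 2 * ((k * a) ^ 2 - (k * b - k * d) ^ 2) = k ^ 2 * (2 * (a ^ 2 - (b - d) ^ 2)) by ring,
      show k * b * (k * d) = k ^ 2 * (b * d) by ring, mul_div_mul_left _ _ (by positivity)]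
  exact h _ _ _

/-- The metric with eigenvalues `1 / v_j + 1 / v_k`. -/
noncomputable def metricOfRecip (v : Fin 3 → ℝ) : Fin 3 → ℝ :=
  fun i => 1 / v (i + 1) + 1 / v (i + 2)

lemma metricOfRecip_pos {v : Fin 3 → ℝ} (hv : ∀ i, 0 < v i) (i : Fin 3) :
    0 < metricOfRecip v i :=
  add_pos (one_div_pos.2 (hv _)) (one_div_pos.2 (hv _))

lemma ricSU2_metricOfRecip {v : Fin 3 → ℝ} (hv : ∀ i, 0 < v i)
    (h1 : v 0 * v 1 + v 1 * v 2 + v 2 * v 0 = 1) (i : Fin 3) :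
    RicSU2 (metricOfRecip v) i * (1 + v i ^ 2) = 8 * v i ^ 2 := by
  have e1 : i + 1 + 1 = i + 2 := by revert i; decide
  have e2 : i + 1 + 2 = i := by revert i; decide
  have e3 : i + 2 + 1 = i := by revert i; decide
  have e4 : i + 2 + 2 = i + 1 := by revert i; decide
  have h : (v i + v (i + 1)) * (v i + v (i + 2)) = 1 + v i ^ 2 := by
    fin_cases i
    · simp only [Fin.zero_eta, Fin.isValue, zero_add]; linarith
    · change (v 1 + v 2) * (v 1 + v 0) = 1 + v 1 ^ 2; linarith
    · change (v 2 + v 0) * (v 2 + v 1) = 1 + v 2 ^ 2; linarith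
  simp only [RicSU2, metricOfRecip, e1, e2, e3, e4]
  rw [ricSU2_coord (hv _) (hv _) (hv _), h, div_mul_cancel₀]
  positivity

/-- A metric with positive Ricci curvature is, up to scale, of the form `metricOfRecip v` with `v`
normalized. -/
lemma exists_eq_metricOfRecip {x : Fin 3 → ℝ} (hx : ∀ i, 0 < x i) (hR : ∀ i, 0 < RicSU2 x i) :
    ∃ v : Fin 3 → ℝ, (∀ i, 0 < v i) ∧ v 0 * v 1 + v 1 * v 2 + v 2 * v 0 = 1 ∧
      ∃ k : ℝ, 0 < k ∧ x = fun i => k * metricOfRecip v i := by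
  have num_pos : ∀ a b d : ℝ, 0 < b → 0 < d → 0 < 2 * (a ^ 2 - (b - d) ^ 2) / (b * d) →
      0 < (d + a - b) * (a + b - d) := by
    intro a b d hb hd h
    have := (div_pos_iff_of_pos_right (mul_pos hb hd)).1 h
    linarith
  have hx0 := hx 0
  have hx1 := hx 1
  have hx2 := hx 2
  have h0 := num_pos _ _ _ hx1 hx2 (hR 0)
  have h1 := num_pos _ _ _ hx2 hx0 (hR 1)
  have h2 := num_pos _ _ _ hx0 hx1 (hR 2)
  have hu0 : 0 < x 1 + x 2 - x 0 := by
    by_contra! hn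
    nlinarith
  have hu1 : 0 < x 2 + x 0 - x 1 := by
    by_contra! hn
    nlinarith
  have hu2 : 0 < x 0 + x 1 - x 2 := by
    by_contra! hn
    nlinarith
  obtain ⟨a, ha⟩ : ∃ a, a = x 1 + x 2 - x 0 := ⟨_, rfl⟩
  obtain ⟨b, hb⟩ : ∃ b, b = x 2 + x 0 - x 1 := ⟨_, rfl⟩
  obtain ⟨d, hd⟩ : ∃ d, d = x 0 + x 1 - x 2 := ⟨_, rfl⟩
  rw [← ha] at hu0
  rw [← hb] at hu1
  rw [← hd] at hu2
  have hq : 0 < √(a * b * d / (a + b + d)) := by positivity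
  have hq2 : √(a * b * d / (a + b + d)) ^ 2 = a * b * d / (a + b + d) :=
    Real.sq_sqrt (by positivity)
  generalize √(a * b * d / (a + b + d)) = q at hq hq2
  refine ⟨![q / a, q / b, q / d], ?_, ?_, q / 2, by positivity, ?_⟩
  · intro i
    fin_cases i
    exacts [div_pos hq hu0, div_pos hq hu1, div_pos hq hu2]
  · change q / a * (q / b) + q / b * (q / d) + q / d * (q / a) = 1
    have : q / a * (q / b) + q / b * (q / d) + q / d * (q / a) =
        q ^ 2 * (a + b + d) / (a * b * d) := by
      field_simp
      ring
    rw [this, hq2]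
    field_simp
  · funext i
    fin_cases i
    · change x 0 = q / 2 * (1 / (q / b) + 1 / (q / d))
      field_simp
      linarith
    · change x 1 = q / 2 * (1 / (q / d) + 1 / (q / a))
      field_simp
      linarith
    · change x 2 = q / 2 * (1 / (q / a) + 1 / (q / b))
      field_simp
      linarith

lemma le_of_mul_one_add_sq {a b v w : ℝ} (hv : 0 ≤ v) (hw : 0 ≤ w) (hab : a ≤ b)
    (ha : a * (1 + v ^ 2) = 8 * v ^ 2) (hb : b * (1 + w ^ 2) = 8 * w ^ 2) : v ≤ w := by
  have h : 8 * (w ^ 2 - v ^ 2) = (b - a) * ((1 + v ^ 2) * (1 + w ^ 2)) := by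
    linear_combination (1 + w ^ 2) * ha - (1 + v ^ 2) * hb
  have : 0 ≤ (b - a) * ((1 + v ^ 2) * (1 + w ^ 2)) :=
    mul_nonneg (sub_nonneg.2 hab) (by positivity)
  exact (sq_le_sq₀ hv hw).1 (by linarith)

/-- The normalization of `v` determines the constant `c`. -/
lemma le_of_normalized {T v w : Fin 3 → ℝ} {c c' : ℝ} (hT : ∀ i, 0 < T i)
    (hv : ∀ i, 0 < v i) (hw : ∀ i, 0 < w i)
    (hv1 : v 0 * v 1 + v 1 * v 2 + v 2 * v 0 = 1) (hw1 : w 0 * w 1 + w 1 * w 2 + w 2 * w 0 = 1)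
    (hvc : ∀ i, c * T i * (1 + v i ^ 2) = 8 * v i ^ 2)
    (hwc : ∀ i, c' * T i * (1 + w i ^ 2) = 8 * w i ^ 2) : c' ≤ c := by
  by_contra! hlt
  have key : ∀ i, v i < w i := by
    intro i
    refine lt_of_le_of_ne (le_of_mul_one_add_sq (hv i).le (hw i).le
      (mul_le_mul_of_nonneg_right hlt.le (hT i).le) (hvc i) (hwc i)) fun h => ?_
    have h1 := hvc i
    rw [h, ← hwc i] at h1
    have h2 := mul_right_cancel₀ (by positivity) h1
    exact hlt.ne (mul_right_cancel₀ (hT i).ne' h2)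
  have h01 := mul_lt_mul'' (key 0) (key 1) (hv 0).le (hv 1).le
  have h12 := mul_lt_mul'' (key 1) (key 2) (hv 1).le (hv 2).le
  have h20 := mul_lt_mul'' (key 2) (key 0) (hv 2).le (hv 0).le
  linarith

open Set in
lemma exists_normalized {T : Fin 3 → ℝ} (hT : ∀ i, 0 < T i) :
    ∃ (v : Fin 3 → ℝ) (c : ℝ), (∀ i, 0 < v i) ∧ 0 < c ∧
      v 0 * v 1 + v 1 * v 2 + v 2 * v 0 = 1 ∧ ∀ i, c * T i * (1 + v i ^ 2) = 8 * v i ^ 2 := by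
  obtain ⟨m, hm⟩ := Finite.exists_max T
  have hM := hT m
  have hden : ∀ i, ∀ s : ℝ, 0 ≤ s → 0 < T m + (T m - T i) * s := fun i s hs =>
    add_pos_of_pos_of_nonneg hM (mul_nonneg (sub_nonneg.2 (hm i)) hs)
  let v : ℝ → Fin 3 → ℝ := fun s i => √(T i * s / (T m + (T m - T i) * s))
  have hv2 : ∀ s, 0 ≤ s → ∀ i, v s i ^ 2 = T i * s / (T m + (T m - T i) * s) := fun s hs i =>
    Real.sq_sqrt (div_nonneg (mul_nonneg (hT i).le hs) (hden i s hs).le)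
  have hcont : ∀ i, ContinuousOn (fun s => v s i) (Ici 0) := by
    intro i
    refine ContinuousOn.sqrt (ContinuousOn.div (by fun_prop) (by fun_prop) ?_)
    exact fun s hs => (hden i s hs).ne'
  have hnn : ∀ s i, 0 ≤ v s i := fun s i => Real.sqrt_nonneg _
  let F : ℝ → ℝ := fun s => v s 0 * v s 1 + v s 1 * v s 2 + v s 2 * v s 0
  have hF : ContinuousOn F (Ici 0) :=
    (((hcont 0).mul (hcont 1)).add ((hcont 1).mul (hcont 2))).add ((hcont 2).mul (hcont 0))
  have hF0 : F 0 = 0 := by simp [F, v]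
  have hF_ge : ∀ s, v s m * v s (m + 1) ≤ F s := by
    intro s
    have h01 := mul_nonneg (hnn s 0) (hnn s 1)
    have h12 := mul_nonneg (hnn s 1) (hnn s 2)
    have h20 := mul_nonneg (hnn s 2) (hnn s 0)
    clear_value v
    fin_cases m
    · change v s 0 * v s 1 ≤ v s 0 * v s 1 + v s 1 * v s 2 + v s 2 * v s 0; linarith
    · change v s 1 * v s 2 ≤ v s 0 * v s 1 + v s 1 * v s 2 + v s 2 * v s 0; linarith
    · change v s 2 * v s 0 ≤ v s 0 * v s 1 + v s 1 * v s 2 + v s 2 * v s 0; linarith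
  obtain ⟨S, hS0, hS1⟩ : ∃ S, 0 ≤ S ∧ 1 ≤ F S := by
    have ht := hT (m + 1)
    have hS : 0 ≤ 1 + 2 * T m / T (m + 1) := by positivity
    refine ⟨1 + 2 * T m / T (m + 1), hS, le_trans ?_ (hF_ge _)⟩
    rw [← one_le_sq_iff₀ (mul_nonneg (hnn _ _) (hnn _ _)), mul_pow, hv2 _ hS, hv2 _ hS, sub_self,
      zero_mul, add_zero, mul_div_cancel_left₀ _ hM.ne', ← mul_div_assoc,
      one_le_div (hden _ _ hS)]
    have hd : T (m + 1) * (1 + 2 * T m / T (m + 1)) = T (m + 1) + 2 * T m := by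
      field_simp
    generalize 1 + 2 * T m / T (m + 1) = S at hS hd
    nlinarith
  obtain ⟨s, hs, hs1⟩ : ∃ s ∈ Icc 0 S, F s = 1 :=
    intermediate_value_Icc hS0 (hF.mono Icc_subset_Ici_self) ⟨hF0.le.trans zero_le_one, hS1⟩
  have hspos : 0 < s := by
    refine lt_of_le_of_ne hs.1 fun h => ?_
    rw [← h, hF0] at hs1
    exact zero_ne_one hs1
  refine ⟨v s, 8 * s / (T m * (1 + s)), fun i => Real.sqrt_pos.2
    (div_pos (mul_pos (hT i) hspos) (hden i s hs.1)), by positivity, hs1, fun i => ?_⟩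
  have hd := hden i s hs.1
  rw [hv2 s hs.1]
  obtain ⟨D, hD⟩ : ∃ D, D = T m + (T m - T i) * s := ⟨_, rfl⟩
  rw [← hD] at hd ⊢
  field_simp
  linear_combination T i * hD

theorem stmt_6 (T : Fin 3 → ℝ) (hT : ∀ i, 0 < T i) :
    ∃ (x : Fin 3 → ℝ) (c : ℝ), (∀ i, 0 < x i) ∧ 0 < c ∧
      (∀ i, RicSU2 x i = c * T i) ∧
      ∀ (x' : Fin 3 → ℝ) (c' : ℝ), (∀ i, 0 < x' i) → 0 < c' →
        (∀ i, RicSU2 x' i = c' * T i) →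
        c' = c ∧ ∃ lam : ℝ, 0 < lam ∧ ∀ i, x' i = lam * x i := by
  obtain ⟨v, c, hv, hc, hv1, hvc⟩ := exists_normalized hT
  refine ⟨metricOfRecip v, c, metricOfRecip_pos hv, hc, fun i => ?_, ?_⟩
  · have h := ricSU2_metricOfRecip hv hv1 i
    rw [← hvc i] at h
    exact mul_right_cancel₀ (by positivity) h
  · intro x' c' hx' hc' hR
    obtain ⟨w, hw, hw1, k, hk, rfl⟩ := exists_eq_metricOfRecip hx' fun i => by
      rw [hR i]
      exact mul_pos hc' (hT i)
    have hwc : ∀ i, c' * T i * (1 + w i ^ 2) = 8 * w i ^ 2 := fun i => by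
      rw [← hR i, ricSU2_smul hk]
      exact ricSU2_metricOfRecip hw hw1 i
    obtain rfl : c' = c := le_antisymm (le_of_normalized hT hv hw hv1 hw1 hvc hwc)
      (le_of_normalized hT hw hv hw1 hv1 hwc hvc)
    obtain rfl : w = v := funext fun i => le_antisymm
      (le_of_mul_one_add_sq (hw i).le (hv i).le le_rfl (hwc i) (hvc i))
      (le_of_mul_one_add_sq (hv i).le (hw i).le le_rfl (hvc i) (hwc i))
    exact ⟨rfl, k, hk, fun _ => rfl⟩
end

section
/- Let x = (x₁,x₂,x₃) ∈ (0,∞)³ and write r_i = R(x)_i. Assume r_i > 0 for i = 1,2,3 (i.e., the metric has positive definite Ricci curvature). Then for all i,j ∈ {1,2,3}: if x_i/x_j ≥ 1 then r_i/r_j ≥ x_i/x_j, and if x_i/x_j < 1 then r_i/r_j < x_i/x_j. -/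
/-- Positive Ricci curvature forces the strict triangle inequalities on the eigenvalues. -/
theorem triangle_of_ricSU2_pos {x : Fin 3 → ℝ} (hx : ∀ i, 0 < x i)
    (hr : ∀ i, 0 < RicSU2 x i) :
    0 < x 1 + x 2 - x 0 ∧ 0 < x 2 + x 0 - x 1 ∧ 0 < x 0 + x 1 - x 2 := by
  have key : ∀ i, 0 < (x i + x (i + 1) - x (i + 2)) * (x (i + 2) + x i - x (i + 1)) := by
    intro i
    have h := hr i
    rw [RicSU2, div_pos_iff_of_pos_right (mul_pos (hx _) (hx _))] at h
    linarith
  have h0 : 0 < (x 0 + x 1 - x 2) * (x 2 + x 0 - x 1) := key 0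
  have h1 : 0 < (x 1 + x 2 - x 0) * (x 0 + x 1 - x 2) := key 1
  have p0 := hx 0
  have hs : 0 < x 0 + x 1 - x 2 := by
    by_contra! hs
    linarith [neg_of_mul_pos_right h0 hs]
  exact ⟨pos_of_mul_pos_left h1 hs.le, pos_of_mul_pos_right h0 hs.le, hs⟩

/-- A ratio of Ricci eigenvalues is the ratio of the metric eigenvalues, times a positive factor
`p / q` whose excess `p - q` is twice the difference of the metric eigenvalues. -/
theorem exists_ricSU2_div_eq {x : Fin 3 → ℝ} (hx : ∀ i, 0 < x i)
    (hr : ∀ i, 0 < RicSU2 x i) (i j : Fin 3) :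
    ∃ p q : ℝ, 0 < p ∧ 0 < q ∧ p - q = 2 * (x i - x j) ∧
      RicSU2 x i / RicSU2 x j = p / q * (x i / x j) := by
  obtain ⟨ha, hb, hc⟩ := triangle_of_ricSU2_pos hx hr
  have p0 := hx 0
  have p1 := hx 1
  have p2 := hx 2
  have e0 : RicSU2 x 0 = 2 * ((x 2 + x 0 - x 1) * (x 0 + x 1 - x 2)) / (x 1 * x 2) := by
    change 2 * (x 0 ^ 2 - (x 1 - x 2) ^ 2) / (x 1 * x 2) = _
    ring
  have e1 : RicSU2 x 1 = 2 * ((x 1 + x 2 - x 0) * (x 0 + x 1 - x 2)) / (x 2 * x 0) := by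
    change 2 * (x 1 ^ 2 - (x 2 - x 0) ^ 2) / (x 2 * x 0) = _
    ring
  have e2 : RicSU2 x 2 = 2 * ((x 1 + x 2 - x 0) * (x 2 + x 0 - x 1)) / (x 0 * x 1) := by
    change 2 * (x 2 ^ 2 - (x 0 - x 1) ^ 2) / (x 0 * x 1) = _
    ring
  rcases eq_or_ne i j with rfl | hij
  · exact ⟨1, 1, one_pos, one_pos, by ring, by
      rw [div_self (hr i).ne', div_self (hx i).ne']; norm_num⟩
  let g : Fin 3 → ℝ := ![x 1 + x 2 - x 0, x 2 + x 0 - x 1, x 0 + x 1 - x 2]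
  refine ⟨g j, g i, ?_, ?_, ?_, ?_⟩
  · fin_cases j <;> assumption
  · fin_cases i <;> assumption
  · fin_cases i <;> fin_cases j <;> simp [g] <;> ring
  · have ha' := ha.ne'
    have hb' := hb.ne'
    have hc' := hc.ne'
    fin_cases i <;> fin_cases j <;> simp [g, e0, e1, e2] at hij ⊢ <;> field_simp

theorem stmt_7 (x : Fin 3 → ℝ) (hx : ∀ i, 0 < x i)
    (hr : ∀ i, 0 < RicSU2 x i) :
    ∀ i j : Fin 3,
      (1 ≤ x i / x j → x i / x j ≤ RicSU2 x i / RicSU2 x j) ∧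
      (x i / x j < 1 → RicSU2 x i / RicSU2 x j < x i / x j) := by
  intro i j
  obtain ⟨p, q, hp, hq, hpq, h⟩ := exists_ricSU2_div_eq hx hr i j
  have hpos : 0 < x i / x j := div_pos (hx i) (hx j)
  rw [h, one_le_div (hx j), div_lt_one (hx j)]
  constructor
  · intro hle
    exact le_mul_of_one_le_left hpos.le ((one_le_div hq).2 (by linarith))
  · intro hlt
    exact mul_lt_of_lt_one_left hpos ((div_lt_one hq).2 (by linarith))
end

section
/- For every y = (y₁,y₂,y₃) ∈ (0,∞)³ there exist a unique constant c > 0 and a unique sequence (x^{(i)})_{i≥1} of elements of (0,∞)³ such that R(x^{(1)}) = (c y₁, c y₂, c y₃) and R(x^{(i+1)}) = x^{(i)} for all i ≥ 1. Moreover, x^{(i)} converges to (2,2,2) as i → ∞. -/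
open Filter Topology

/-- The Ricci map is homogeneous of degree zero. -/
theorem RicSU2_smul {r : ℝ} (hr : 0 < r) (x : Fin 3 → ℝ) :
    RicSU2 (fun i => r * x i) = RicSU2 x := by
  funext i
  have h : (2 * ((r * x i) ^ 2 - (r * x (i + 1) - r * x (i + 2)) ^ 2)) =
      r ^ 2 * (2 * (x i ^ 2 - (x (i + 1) - x (i + 2)) ^ 2)) := by ring
  have h' : (r * x (i + 1)) * (r * x (i + 2)) = r ^ 2 * (x (i + 1) * x (i + 2)) := by ring
  simp only [RicSU2]
  rw [h, h', mul_div_mul_left _ _ (by positivity)]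

/-- A metric with positive Ricci curvature satisfies the strict triangle inequalities. -/
theorem two_mul_lt_sum_of_RicSU2_pos {x : Fin 3 → ℝ} (hx : ∀ i, 0 < x i)
    (hR : ∀ i, 0 < RicSU2 x i) (i : Fin 3) : 2 * x i < ∑ j, x j := by
  have key : ∀ j, |x (j + 1) - x (j + 2)| < x j := fun j => by
    have h := hR j
    simp only [RicSU2] at h
    rw [lt_div_iff₀ (mul_pos (hx _) (hx _))] at h
    exact abs_lt_of_sq_lt_sq (by linarith) (hx j).le
  have h0 := abs_lt.mp (key 0)
  have h1 := abs_lt.mp (key 1)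
  have h2 := abs_lt.mp (key 2)
  rw [Fin.sum_univ_three]
  fin_cases i <;> simp at h0 h1 h2 ⊢ <;> linarith

/-- The common factor in the expression of `RicSU2 x i` as a multiple of
`x i / (∑ j, x j - 2 * x i)`. -/
noncomputable def ricFactor (x : Fin 3 → ℝ) : ℝ :=
  2 * ∏ i, ((∑ j, x j - 2 * x i) / x i)

theorem ricFactor_pos {x : Fin 3 → ℝ} (hx : ∀ i, 0 < x i)
    (ht : ∀ i, 2 * x i < ∑ j, x j) : 0 < ricFactor x :=
  mul_pos two_pos (Finset.prod_pos fun i _ => div_pos (sub_pos.mpr (ht i)) (hx i))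

theorem RicSU2_eq {x : Fin 3 → ℝ} (hx : ∀ i, 0 < x i)
    (ht : ∀ i, 2 * x i < ∑ j, x j) (i : Fin 3) :
    RicSU2 x i = ricFactor x * (x i / (∑ j, x j - 2 * x i)) := by
  have h0 := hx 0
  have h1 := hx 1
  have h2 := hx 2
  have a0 := (sub_pos.mpr (ht 0)).ne'
  have a1 := (sub_pos.mpr (ht 1)).ne'
  have a2 := (sub_pos.mpr (ht 2)).ne'
  simp only [RicSU2, ricFactor, Fin.prod_univ_three]
  rw [Fin.sum_univ_three] at *
  fin_cases i <;> simp <;> field_simp <;> ring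

theorem sum_div_strictMono {z : Fin 3 → ℝ} (hz : ∀ i, 0 < z i) {l m : ℝ} (hl : 0 < l)
    (hlm : l < m) : ∑ i, l * z i / (1 + 2 * (l * z i)) < ∑ i, m * z i / (1 + 2 * (m * z i)) := by
  refine Finset.sum_lt_sum_of_nonempty Finset.univ_nonempty fun i _ => ?_
  have h1 : 0 < l * z i := mul_pos hl (hz i)
  have h2 : l * z i < m * z i := mul_lt_mul_of_pos_right hlm (hz i)
  rw [div_lt_div_iff₀ (by linarith) (by linarith)]
  nlinarith

/-- Normalized eigenvalues are recovered from the Ricci curvature up to one parameter. -/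
theorem div_sum_eq {x : Fin 3 → ℝ} (hx : ∀ i, 0 < x i)
    (ht : ∀ i, 2 * x i < ∑ j, x j) (i : Fin 3) :
    x i / ∑ j, x j = (ricFactor x)⁻¹ * RicSU2 x i / (1 + 2 * ((ricFactor x)⁻¹ * RicSU2 x i)) := by
  have hP := ricFactor_pos hx ht
  have hi := hx i
  have hti := sub_pos.mpr (ht i)
  have hS : 0 < ∑ j, x j := Finset.sum_pos (fun j _ => hx j) Finset.univ_nonempty
  have h : (ricFactor x)⁻¹ * RicSU2 x i = x i / (∑ j, x j - 2 * x i) := by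
    rw [RicSU2_eq hx ht, inv_mul_cancel_left₀ hP.ne']
  rw [h]
  have h1 : 1 + 2 * (x i / (∑ j, x j - 2 * x i)) = (∑ j, x j) / (∑ j, x j - 2 * x i) := by
    field_simp
    ring
  rw [h1, div_div_div_cancel_right₀ hti.ne']

/-- Metrics with proportional positive Ricci curvatures are proportional. -/
theorem exists_eq_mul_of_RicSU2_eq_mul {x x' : Fin 3 → ℝ} (hx : ∀ i, 0 < x i)
    (hx' : ∀ i, 0 < x' i) (hR : ∀ i, 0 < RicSU2 x i) {r : ℝ} (hr : 0 < r)
    (h : RicSU2 x' = fun i => r * RicSU2 x i) :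
    ∃ s, 0 < s ∧ x' = fun i => s * x i := by
  have hR' : ∀ i, 0 < RicSU2 x' i := fun i => by rw [h]; exact mul_pos hr (hR i)
  have ht := two_mul_lt_sum_of_RicSU2_pos hx hR
  have ht' := two_mul_lt_sum_of_RicSU2_pos hx' hR'
  have hS : 0 < ∑ j, x j := Finset.sum_pos (fun j _ => hx j) Finset.univ_nonempty
  have hS' : 0 < ∑ j, x' j := Finset.sum_pos (fun j _ => hx' j) Finset.univ_nonempty
  have hl := inv_pos.mpr (ricFactor_pos hx ht)
  have hl' : 0 < (ricFactor x')⁻¹ * r := mul_pos (inv_pos.mpr (ricFactor_pos hx' ht')) hr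
  have e := div_sum_eq hx ht
  have e' := div_sum_eq hx' ht'
  simp only [h, ← mul_assoc _ r] at e'
  have s1 : ∑ i, x i / ∑ j, x j = 1 := by rw [← Finset.sum_div, div_self hS.ne']
  have s1' : ∑ i, x' i / ∑ j, x' j = 1 := by rw [← Finset.sum_div, div_self hS'.ne']
  rw [Finset.sum_congr rfl fun i _ => e i] at s1
  rw [Finset.sum_congr rfl fun i _ => e' i] at s1'
  have hll : (ricFactor x)⁻¹ = (ricFactor x')⁻¹ * r := by
    rcases lt_trichotomy (ricFactor x)⁻¹ ((ricFactor x')⁻¹ * r) with hlt | heq | hgt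
    · exact absurd (sum_div_strictMono hR hl hlt) (by rw [s1, s1']; exact lt_irrefl _)
    · exact heq
    · exact absurd (sum_div_strictMono hR hl' hgt) (by rw [s1, s1']; exact lt_irrefl _)
  refine ⟨(∑ j, x' j) / ∑ j, x j, div_pos hS' hS, funext fun i => ?_⟩
  have hi : x' i / ∑ j, x' j = x i / ∑ j, x j := by rw [e, e', hll]
  rw [div_eq_iff hS'.ne'] at hi
  rw [hi]
  ring

/-- Every positive triple is, up to scaling, the Ricci curvature of some metric. -/
theorem exists_RicSU2_eq_mul {z : Fin 3 → ℝ} (hz : ∀ i, 0 < z i) :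
    ∃ t : Fin 3 → ℝ, (∀ i, 0 < t i) ∧ ∃ c, 0 < c ∧ RicSU2 t = fun i => c * z i := by
  set M : ℝ := ∑ i, (z i)⁻¹
  have hM : 0 ≤ M := Finset.sum_nonneg fun i _ => (inv_pos.mpr (hz i)).le
  have hcont : ContinuousOn (fun l : ℝ => ∑ i, l * z i / (1 + 2 * (l * z i))) (Set.Icc 0 M) := by
    refine continuousOn_finsetSum _ fun i _ => ContinuousOn.div (by fun_prop) (by fun_prop) ?_
    intro l hl
    have := mul_nonneg hl.1 (hz i).le
    positivity
  have hmem : (1 : ℝ) ∈ Set.Icc (∑ i, 0 * z i / (1 + 2 * (0 * z i)))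
      (∑ i, M * z i / (1 + 2 * (M * z i))) := by
    refine ⟨by simp, ?_⟩
    have hi : ∀ i, (1 / 3 : ℝ) ≤ M * z i / (1 + 2 * (M * z i)) := fun i => by
      have h1 : (z i)⁻¹ ≤ M := Finset.single_le_sum (f := fun i => (z i)⁻¹)
        (fun j _ => (inv_pos.mpr (hz j)).le) (Finset.mem_univ i)
      have h2 : 1 ≤ M * z i := by
        have := mul_le_mul_of_nonneg_right h1 (hz i).le
        rwa [inv_mul_cancel₀ (hz i).ne'] at this
      rw [div_le_div_iff₀ (by norm_num) (by linarith)]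
      linarith
    calc (1 : ℝ) = ∑ _i : Fin 3, (1 / 3 : ℝ) := by simp
      _ ≤ _ := Finset.sum_le_sum fun i _ => hi i
  obtain ⟨l, hl, hsum⟩ := intermediate_value_Icc hM hcont hmem
  have hl0 : 0 < l := by
    refine lt_of_le_of_ne hl.1 fun h => ?_
    subst h
    simp at hsum
  have hlz : ∀ i, 0 < l * z i := fun i => mul_pos hl0 (hz i)
  have hden : ∀ i, 0 < 1 + 2 * (l * z i) := fun i => by linarith [hlz i]
  have htpos : ∀ i, 0 < l * z i / (1 + 2 * (l * z i)) := fun i => div_pos (hlz i) (hden i)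
  have hsub : ∀ i, 1 - 2 * (l * z i / (1 + 2 * (l * z i))) = 1 / (1 + 2 * (l * z i)) := fun i => by
    rw [sub_eq_iff_eq_add, ← mul_div_assoc, ← add_div, div_self (hden i).ne']
  have htri : ∀ i, 2 * (l * z i / (1 + 2 * (l * z i))) <
      ∑ j, l * z j / (1 + 2 * (l * z j)) := fun i => by
    have h := one_div_pos.mpr (hden i)
    rw [← hsub] at h
    simp only at hsum
    linarith
  refine ⟨fun i => l * z i / (1 + 2 * (l * z i)), htpos,
    ricFactor (fun i => l * z i / (1 + 2 * (l * z i))) * l,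
    mul_pos (ricFactor_pos htpos htri) hl0, funext fun i => ?_⟩
  rw [RicSU2_eq htpos htri]
  simp only at hsum
  rw [hsum, hsub, div_div_div_cancel_right₀ (hden i).ne', div_one, mul_assoc]

/-- The scale-invariant differences `(∑ l, x l) * (1 / x i - 1 / x j)` shrink by a factor of at
least three under an inverse Ricci step. -/
theorem abs_sum_mul_sub_le {x : Fin 3 → ℝ} (hx : ∀ i, 0 < x i)
    (hR : ∀ i, 0 < RicSU2 x i) (i j : Fin 3) :
    |(∑ l, x l) * ((x i)⁻¹ - (x j)⁻¹)| ≤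
      1 / 3 * |(∑ l, RicSU2 x l) * ((RicSU2 x i)⁻¹ - (RicSU2 x j)⁻¹)| := by
  have ht := two_mul_lt_sum_of_RicSU2_pos hx hR
  have hP := ricFactor_pos hx ht
  have hinv : ∀ i, (∑ l, x l) * (x i)⁻¹ - 2 = ricFactor x * (RicSU2 x i)⁻¹ := fun i => by
    have := (hx i).ne'
    have := (sub_pos.mpr (ht i)).ne'
    rw [RicSU2_eq hx ht]
    field_simp
  have hdiff : (∑ l, x l) * ((x i)⁻¹ - (x j)⁻¹) =
      ricFactor x * ((RicSU2 x i)⁻¹ - (RicSU2 x j)⁻¹) := by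
    linear_combination hinv i - hinv j
  have hnesbitt : 3 ≤ ∑ l, x l / (∑ m, x m - 2 * x l) := by
    have a0 := sub_pos.mpr (ht 0)
    have a1 := sub_pos.mpr (ht 1)
    have a2 := sub_pos.mpr (ht 2)
    rw [Fin.sum_univ_three (f := fun l => x l / (∑ m, x m - 2 * x l))]
    generalize ha : ∑ m, x m - 2 * x 0 = a at *
    generalize hb : ∑ m, x m - 2 * x 1 = b at *
    generalize hc : ∑ m, x m - 2 * x 2 = c at *
    rw [Fin.sum_univ_three] at ha hb hc
    have e0 : x 0 = (b + c) / 2 := by linarith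
    have e1 : x 1 = (a + c) / 2 := by linarith
    have e2 : x 2 = (a + b) / 2 := by linarith
    rw [e0, e1, e2, div_add_div _ _ a0.ne' a1.ne', div_add_div _ _ (mul_pos a0 a1).ne' a2.ne',
      le_div_iff₀ (by positivity)]
    nlinarith [mul_nonneg a0.le (sq_nonneg (b - c)), mul_nonneg a1.le (sq_nonneg (a - c)),
      mul_nonneg a2.le (sq_nonneg (a - b))]
  have hsum : ricFactor x ≤ 1 / 3 * ∑ l, RicSU2 x l := by
    rw [Finset.sum_congr rfl fun l _ => RicSU2_eq hx ht l, ← Finset.mul_sum]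
    nlinarith
  rw [hdiff, abs_mul, abs_mul, abs_of_pos hP,
    abs_of_pos (Finset.sum_pos (fun l _ => hR l) Finset.univ_nonempty), ← mul_assoc]
  exact mul_le_mul_of_nonneg_right hsum (abs_nonneg _)

theorem tendsto_of_RicSU2_succ {x : ℕ → Fin 3 → ℝ} (hx : ∀ k i, 0 < x k i)
    (hR : ∀ k, RicSU2 (x (k + 1)) = x k) : Tendsto x atTop (𝓝 fun _ => (2 : ℝ)) := by
  have hS : ∀ k, 0 < ∑ l, x k l := fun k =>
    Finset.sum_pos (fun l _ => hx k l) Finset.univ_nonempty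
  have hbound : ∀ i j k, |(∑ l, x k l) * ((x k i)⁻¹ - (x k j)⁻¹)| ≤
      (1 / 3) ^ k * |(∑ l, x 0 l) * ((x 0 i)⁻¹ - (x 0 j)⁻¹)| := fun i j k => by
    induction k with
    | zero => simp
    | succ k ih =>
      have h := abs_sum_mul_sub_le (hx (k + 1)) (by rw [hR]; exact hx k) i j
      rw [hR] at h
      rw [pow_succ', mul_assoc]
      exact h.trans (mul_le_mul_of_nonneg_left ih (by norm_num))
  have hle : ∀ k i, x k i / ∑ l, x k l ≤ 1 := fun k i => by
    rw [div_le_one (hS k)]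
    exact Finset.single_le_sum (fun l _ => (hx k l).le) (Finset.mem_univ i)
  have hdiff : ∀ i j, Tendsto (fun k => x k i / (∑ l, x k l) - x k j / ∑ l, x k l)
      atTop (𝓝 0) := fun i j => by
    have hlim : Tendsto (fun k : ℕ => (1 / 3 : ℝ) ^ k *
        |(∑ l, x 0 l) * ((x 0 j)⁻¹ - (x 0 i)⁻¹)|) atTop (𝓝 0) := by
      simpa using (tendsto_pow_atTop_nhds_zero_of_lt_one (r := (1 / 3 : ℝ)) (by norm_num)
        (by norm_num)).mul_const |(∑ l, x 0 l) * ((x 0 j)⁻¹ - (x 0 i)⁻¹)|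
    refine squeeze_zero_norm (fun k => le_trans ?_ (hbound j i k)) hlim
    have hi := (hx k i).ne'
    have hj := (hx k j).ne'
    have hk := (hS k).ne'
    have heq : x k i / (∑ l, x k l) - x k j / ∑ l, x k l =
        (x k i / ∑ l, x k l) * (x k j / ∑ l, x k l) *
          ((∑ l, x k l) * ((x k j)⁻¹ - (x k i)⁻¹)) := by
      field_simp
    rw [Real.norm_eq_abs, heq, abs_mul]
    refine mul_le_of_le_one_left (abs_nonneg _) ?_
    have pi := (div_pos (hx k i) (hS k)).le
    have pj := (div_pos (hx k j) (hS k)).le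
    rw [abs_of_nonneg (mul_nonneg pi pj)]
    exact mul_le_one₀ (hle k i) pj (hle k j)
  have hnorm : ∀ i, Tendsto (fun k => x k i / ∑ l, x k l) atTop (𝓝 (1 / 3)) := fun i => by
    have h : Tendsto (fun k => (1 / 3 : ℝ) + 1 / 3 *
        ∑ j, (x k i / (∑ l, x k l) - x k j / ∑ l, x k l)) atTop (𝓝 (1 / 3)) := by
      simpa using ((tendsto_finsetSum Finset.univ fun j _ => hdiff i j).const_mul
        (1 / 3 : ℝ)).const_add (1 / 3 : ℝ)
    refine h.congr fun k => ?_
    rw [Finset.sum_sub_distrib, ← Finset.sum_div (f := x k), div_self (hS k).ne']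
    simp
    ring
  refine tendsto_pi_nhds.mpr fun i => ?_
  have hstep : ∀ k, RicSU2 (fun j => x (k + 1) j / ∑ l, x (k + 1) l) i = x k i := fun k => by
    rw [← hR k, ← RicSU2_smul (inv_pos.mpr (hS (k + 1))) (x (k + 1))]
    simp only [div_eq_inv_mul]
  refine Tendsto.congr hstep ?_
  have h := fun j => (hnorm j).comp (tendsto_add_atTop_nat 1)
  have hlim := ((((h i).pow 2).sub (((h (i + 1)).sub (h (i + 2))).pow 2)).const_mul 2).div
    ((h (i + 1)).mul (h (i + 2))) (by norm_num)
  norm_num at hlim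
  exact hlim

theorem exists_RicSU2_sequence {y : Fin 3 → ℝ} (hy : ∀ i, 0 < y i) :
    ∃ (c : ℝ) (x : ℕ → Fin 3 → ℝ), 0 < c ∧ (∀ k, ∀ i, 0 < x k i) ∧
      RicSU2 (x 0) = (fun i => c * y i) ∧ ∀ k, RicSU2 (x (k + 1)) = x k := by
  choose F hF C hC hFC using fun z : {z : Fin 3 → ℝ // ∀ i, 0 < z i} => exists_RicSU2_eq_mul z.2
  let t : ℕ → {z : Fin 3 → ℝ // ∀ i, 0 < z i} := fun k => (fun z => ⟨F z, hF z⟩)^[k] ⟨y, hy⟩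
  have ht : ∀ k, RicSU2 (t (k + 1)).1 = fun i => C (t k) * (t k).1 i := fun k => by
    simp only [t, Function.iterate_succ_apply']
    exact hFC _
  refine ⟨C (t 0), fun k => RicSU2 (t (k + 2)).1, hC _, fun k i => ?_, ?_, fun k => ?_⟩
  · simp only [ht]
    exact mul_pos (hC _) ((t (k + 1)).2 i)
  · simp only [ht (0 + 1)]
    rw [RicSU2_smul (hC _), ht]
    rfl
  · simp only [ht (k + 1 + 1)]
    rw [RicSU2_smul (hC _)]

theorem RicSU2_sequence_unique {y : Fin 3 → ℝ} (hy : ∀ i, 0 < y i) {c c' : ℝ}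
    {x x' : ℕ → Fin 3 → ℝ} (hc : 0 < c) (hx : ∀ k, ∀ i, 0 < x k i)
    (h0 : RicSU2 (x 0) = fun i => c * y i) (hR : ∀ k, RicSU2 (x (k + 1)) = x k)
    (hc' : 0 < c') (hx' : ∀ k, ∀ i, 0 < x' k i)
    (h0' : RicSU2 (x' 0) = fun i => c' * y i) (hR' : ∀ k, RicSU2 (x' (k + 1)) = x' k) :
    c = c' ∧ x = x' := by
  have hprop : ∀ k, ∃ s, 0 < s ∧ x' k = fun i => s * x k i := fun k => by
    induction k with
    | zero =>
      refine exists_eq_mul_of_RicSU2_eq_mul (hx 0) (hx' 0) (fun i => ?_) (div_pos hc' hc) ?_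
      · rw [h0]
        exact mul_pos hc (hy i)
      · rw [h0, h0']
        funext i
        field_simp
    | succ k ih =>
      obtain ⟨s, hs, h⟩ := ih
      refine exists_eq_mul_of_RicSU2_eq_mul (hx _) (hx' _) (fun i => ?_) hs ?_
      · rw [hR]
        exact hx k i
      · rw [hR, hR', h]
  have hric : ∀ k, RicSU2 (x k) = RicSU2 (x' k) := fun k => by
    obtain ⟨s, hs, h⟩ := hprop k
    rw [h, RicSU2_smul hs]
  refine ⟨?_, funext fun k => by rw [← hR, ← hR', hric]⟩
  have h := congrFun (hric 0) 0
  rw [h0, h0'] at h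
  exact mul_right_cancel₀ (hy 0).ne' h

theorem stmt_8 (y : Fin 3 → ℝ) (hy : ∀ i, 0 < y i) :
    (∃ (c : ℝ) (x : ℕ → Fin 3 → ℝ), 0 < c ∧
        (∀ k, ∀ i, 0 < x k i) ∧
        RicSU2 (x 0) = (fun i => c * y i) ∧
        ∀ k, RicSU2 (x (k + 1)) = x k) ∧
    (∀ (c c' : ℝ) (x x' : ℕ → Fin 3 → ℝ),
        0 < c → (∀ k, ∀ i, 0 < x k i) →
          RicSU2 (x 0) = (fun i => c * y i) → (∀ k, RicSU2 (x (k + 1)) = x k) →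
        0 < c' → (∀ k, ∀ i, 0 < x' k i) →
          RicSU2 (x' 0) = (fun i => c' * y i) → (∀ k, RicSU2 (x' (k + 1)) = x' k) →
        c = c' ∧ x = x') ∧
    (∀ (c : ℝ) (x : ℕ → Fin 3 → ℝ),
        0 < c → (∀ k, ∀ i, 0 < x k i) →
          RicSU2 (x 0) = (fun i => c * y i) → (∀ k, RicSU2 (x (k + 1)) = x k) →
        Tendsto x atTop (𝓝 fun _ => (2 : ℝ))) := by
  exact ⟨exists_RicSU2_sequence hy,
    fun _ _ _ _ hc hx h0 hR hc' hx' h0' hR' =>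
      RicSU2_sequence_unique hy hc hx h0 hR hc' hx' h0' hR',
    fun _ _ _ hx _ hR => tendsto_of_RicSU2_succ hx hR⟩
end

section
/- Let ν > 0. There exists a sequence (x^{(i)})_{i≤1} of elements of (0,∞)³ with x^{(1)} = (ν, 2, 2) and x^{(i−1)} = R(x^{(i)}) for every integer i ≤ 1 if and only if ν ∈ (0, 2]. -/
/-- On Berger metrics the Ricci map depends only on the ratio of the eigenvalues. -/
lemma RicSU2_berger {a b : ℝ} (ha : 0 < a) (hb : 0 < b) :
    RicSU2 ![a, b, b] = ![2 * (a / b) ^ 2, 4 - 2 * (a / b), 4 - 2 * (a / b)] := by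
  have h2 : (2 : Fin 3) + 2 = 1 := rfl
  have h1 : (1 : Fin 3) + 2 = 0 := rfl
  have h3 : (2 : Fin 3) + 1 = 0 := rfl
  have h4 : (1 : Fin 3) + 1 = 2 := rfl
  funext k
  fin_cases k <;> simp [RicSU2, h1, h2, h3, h4] <;> field_simp <;> ring

lemma RicSU2_iterate_berger {ν : ℝ} (hν : 0 < ν) (hν2 : ν ≤ 2) (n : ℕ) :
    ∃ a b : ℝ, 0 < a ∧ a ≤ b ∧ RicSU2^[n] ![ν, 2, 2] = ![a, b, b] := by
  induction n with
  | zero => exact ⟨ν, 2, hν, hν2, rfl⟩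
  | succ n ih =>
    obtain ⟨a, b, ha, hab, h⟩ := ih
    have hb : 0 < b := ha.trans_le hab
    have hr : 0 < a / b := div_pos ha hb
    have hr1 : a / b ≤ 1 := (div_le_one hb).2 hab
    refine ⟨2 * (a / b) ^ 2, 4 - 2 * (a / b), by positivity, by nlinarith, ?_⟩
    rw [Function.iterate_succ_apply', h, RicSU2_berger ha hb]

/-- Along an ancient Ricci iteration, the distance of the ratio of the eigenvalues of a Berger
metric from `1` grows at least geometrically. -/
lemma berger_ratio_growth {ν : ℝ} (hν : 2 < ν) {x : ℤ → Fin 3 → ℝ}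
    (hpos : ∀ i ≤ (1 : ℤ), ∀ k, 0 < x i k) (h1 : x 1 = ![ν, 2, 2])
    (hstep : ∀ i ≤ (1 : ℤ), x (i - 1) = RicSU2 (x i)) (n : ℕ) :
    ∃ a b : ℝ, 0 < a ∧ 0 < b ∧ x (1 - n) = ![a, b, b] ∧
      3 ^ n * (ν / 2 - 1) ≤ a / b - 1 ∧ a / b < 2 := by
  have bound : ∀ i ≤ (1 : ℤ), ∀ a b : ℝ, 0 < a → 0 < b → x i = ![a, b, b] → a / b < 2 := by
    intro i hi a b ha hb h
    have hp := hpos (i - 1) (by omega) 1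
    rw [hstep i hi, h, RicSU2_berger ha hb] at hp
    simp only [Matrix.cons_val_one, Matrix.cons_val_zero] at hp
    linarith
  induction n with
  | zero =>
    refine ⟨ν, 2, by linarith, two_pos, by simpa using h1, by simp, ?_⟩
    exact bound 1 le_rfl ν 2 (by linarith) two_pos h1
  | succ n ih =>
    obtain ⟨a, b, ha, hb, h, hge, hlt⟩ := ih
    have hi : (1 - n : ℤ) ≤ 1 := by omega
    have hx : x (1 - (n + 1 : ℕ)) = ![2 * (a / b) ^ 2, 4 - 2 * (a / b), 4 - 2 * (a / b)] := by
      rw [← RicSU2_berger ha hb, ← h, ← hstep _ hi]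
      congr 1
      push_cast
      ring
    have hr : 0 < a / b := div_pos ha hb
    have hr1 : 0 < a / b - 1 :=
      lt_of_lt_of_le (mul_pos (by positivity) (by linarith)) hge
    have hb' : 0 < 4 - 2 * (a / b) := by linarith
    refine ⟨_, _, by positivity, hb', hx, ?_, bound _ (by omega) _ _ (by positivity) hb' hx⟩
    have key : 3 * (a / b - 1) ≤ 2 * (a / b) ^ 2 / (4 - 2 * (a / b)) - 1 := by
      rw [le_sub_iff_add_le, le_div_iff₀ hb']
      nlinarith [mul_pos hr hr1]
    calc (3 : ℝ) ^ (n + 1) * (ν / 2 - 1) = 3 * (3 ^ n * (ν / 2 - 1)) := by ring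
      _ ≤ 3 * (a / b - 1) := by linarith
      _ ≤ _ := key

theorem stmt_9 (ν : ℝ) (hν : 0 < ν) :
    (∃ x : ℤ → Fin 3 → ℝ,
        (∀ i ≤ (1 : ℤ), ∀ k, 0 < x i k) ∧ x 1 = ![ν, 2, 2] ∧
        ∀ i ≤ (1 : ℤ), x (i - 1) = RicSU2 (x i)) ↔ ν ≤ 2 := by
  constructor
  · rintro ⟨x, hpos, h1, hstep⟩
    by_contra! hν2
    have hc : 0 < ν / 2 - 1 := by linarith
    obtain ⟨n, hn⟩ := pow_unbounded_of_one_lt (1 / (ν / 2 - 1)) (by norm_num : (1 : ℝ) < 3)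
    obtain ⟨a, b, -, -, -, hge, hlt⟩ := berger_ratio_growth hν2 hpos h1 hstep n
    rw [div_lt_iff₀ hc] at hn
    linarith
  · intro hν2
    refine ⟨fun i => RicSU2^[(1 - i).toNat] ![ν, 2, 2], fun i _ k => ?_, rfl, fun i hi => ?_⟩
    · obtain ⟨a, b, ha, hab, h⟩ := RicSU2_iterate_berger hν hν2 (1 - i).toNat
      have hb : 0 < b := ha.trans_le hab
      simp only [h]
      fin_cases k <;> simpa
    · have hn : (1 - (i - 1)).toNat = (1 - i).toNat + 1 := by omega
      simp only [hn, Function.iterate_succ_apply']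
end

section
/- Let ν ∈ (0,2) and let (x^{(i)})_{i≤1} be any sequence of elements of (0,∞)³ with x^{(1)} = (ν, 2, 2) and x^{(i−1)} = R(x^{(i)}) for every integer i ≤ 1 (such a sequence exists). Then, writing x^{(i)} = (x₁^{(i)}, x₂^{(i)}, x₃^{(i)}), one has lim_{i→−∞} x₁^{(i)} = 0 and lim_{i→−∞} x₂^{(i)} = lim_{i→−∞} x₃^{(i)} = 4. -/
open Filter Topology

theorem RicSU2_berger_zero {x : Fin 3 → ℝ} (h : x 1 = x 2) :
    RicSU2 x 0 = 2 * (x 0 / x 2) ^ 2 := by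
  simp only [RicSU2, Fin.isValue, zero_add, show (0 + 2 : Fin 3) = 2 from rfl, h]
  rw [sub_self]
  ring

theorem RicSU2_berger_one {x : Fin 3 → ℝ} (h : x 1 = x 2) (h0 : x 0 ≠ 0) (h2 : x 2 ≠ 0) :
    RicSU2 x 1 = 4 - 2 * (x 0 / x 2) := by
  simp only [RicSU2, Fin.isValue, show (1 + 1 : Fin 3) = 2 from rfl,
    show (1 + 2 : Fin 3) = 0 from rfl, h]
  field_simp
  ring

theorem RicSU2_berger_two {x : Fin 3 → ℝ} (h : x 1 = x 2) (h0 : x 0 ≠ 0) (h2 : x 2 ≠ 0) :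
    RicSU2 x 2 = 4 - 2 * (x 0 / x 2) := by
  simp only [RicSU2, Fin.isValue, show (2 + 1 : Fin 3) = 0 from rfl,
    show (2 + 2 : Fin 3) = 1 from rfl, h]
  field_simp
  ring

/-- Along iterates of `RicSU2` starting at `(ν, 2, 2)`, the ratio of the fiber eigenvalue to the
base eigenvalue decays geometrically. -/
theorem berger_ratio_le {ν : ℝ} (h2 : ν < 2) {y : ℕ → Fin 3 → ℝ}
    (hpos : ∀ n k, 0 < y n k) (hy0 : y 0 = ![ν, 2, 2])
    (hrec : ∀ n, y (n + 1) = RicSU2 (y n)) (n : ℕ) :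
    y n 1 = y n 2 ∧ y n 0 / y n 2 ≤ (ν / 2) ^ (n + 1) := by
  have hν : 0 < ν := by simpa [hy0] using hpos 0 0
  induction n with
  | zero => simp [hy0]
  | succ n ih =>
    obtain ⟨heq, hle⟩ := ih
    have hr : 0 < y n 0 / y n 2 := div_pos (hpos n 0) (hpos n 2)
    have e0 := RicSU2_berger_zero heq
    have e1 := RicSU2_berger_one heq (hpos n 0).ne' (hpos n 2).ne'
    have e2 := RicSU2_berger_two heq (hpos n 0).ne' (hpos n 2).ne'
    rw [hrec, e0, e1, e2]
    refine ⟨rfl, ?_⟩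
    set r := y n 0 / y n 2
    have hrc : r ≤ ν / 2 := hle.trans (pow_le_of_le_one (by positivity) (by linarith) (by simp))
    have hstep : 2 * r ^ 2 / (4 - 2 * r) ≤ r * r := by
      rw [div_le_iff₀ (by linarith)]
      nlinarith [mul_pos hr hr]
    calc 2 * r ^ 2 / (4 - 2 * r) ≤ r * r := hstep
      _ ≤ (ν / 2) ^ (n + 1) * (ν / 2) := by gcongr
      _ = (ν / 2) ^ (n + 1 + 1) := (pow_succ _ _).symm

theorem stmt_10 (ν : ℝ) (h0 : 0 < ν) (h2 : ν < 2)
    (x : ℤ → Fin 3 → ℝ)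
    (hpos : ∀ i ≤ (1 : ℤ), ∀ k, 0 < x i k)
    (hx1 : x 1 = ![ν, 2, 2])
    (hrec : ∀ i ≤ (1 : ℤ), x (i - 1) = RicSU2 (x i)) :
    Tendsto (fun i => x i 0) atBot (𝓝 (0 : ℝ)) ∧
    Tendsto (fun i => x i 1) atBot (𝓝 (4 : ℝ)) ∧
    Tendsto (fun i => x i 2) atBot (𝓝 (4 : ℝ)) := by
  have hle_one (n : ℕ) : (1 : ℤ) - n ≤ 1 := by lia
  have hypos (n : ℕ) (k : Fin 3) : 0 < x (1 - n) k := hpos _ (hle_one n) k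
  have hyrec (n : ℕ) : x (1 - (n + 1 : ℕ)) = RicSU2 (x (1 - n)) := by
    rw [← hrec _ (hle_one n)]
    congr 1
    push_cast
    ring
  have key := berger_ratio_le (y := fun n : ℕ => x (1 - n)) h2 hypos (by simpa using hx1) hyrec
  have hratio : Tendsto (fun n : ℕ => x (1 - n) 0 / x (1 - n) 2) atTop (𝓝 0) := by
    refine squeeze_zero (fun n => (div_pos (hypos n 0) (hypos n 2)).le) (fun n => (key n).2) ?_
    exact (tendsto_add_atTop_iff_nat 1).2
      (tendsto_pow_atTop_nhds_zero_of_lt_one (by positivity) (by linarith))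
  have transfer {k : Fin 3} {L : ℝ}
      (h : Tendsto (fun n : ℕ => x (1 - (n + 1 : ℕ)) k) atTop (𝓝 L)) :
      Tendsto (fun i => x i k) atBot (𝓝 L) := by
    have h' := (tendsto_add_atTop_iff_nat (f := fun n : ℕ => x (1 - n) k) 1).1 h
    have hto : Tendsto (fun i : ℤ => (1 - i).toNat) atBot atTop := by
      refine tendsto_atTop.2 fun b => ?_
      filter_upwards [eventually_le_atBot (1 - b : ℤ)] with i hi
      lia
    refine (h'.comp hto).congr' ?_
    filter_upwards [eventually_le_atBot (1 : ℤ)] with i hi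
    have : (1 : ℤ) - ((1 - i).toNat : ℤ) = i := by lia
    simp only [Function.comp_apply, this]
  have hbase : Tendsto (fun n : ℕ => 4 - 2 * (x (1 - n) 0 / x (1 - n) 2)) atTop (𝓝 4) := by
    simpa using (hratio.const_mul 2).const_sub 4
  refine ⟨transfer ?_, transfer ?_, transfer ?_⟩
  · have hfiber : Tendsto (fun n : ℕ => 2 * (x (1 - n) 0 / x (1 - n) 2) ^ 2) atTop (𝓝 0) := by
      simpa using (hratio.pow 2).const_mul 2
    refine hfiber.congr fun n => ?_
    rw [hyrec, RicSU2_berger_zero (key n).1]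
  · refine hbase.congr fun n => ?_
    rw [hyrec, RicSU2_berger_one (key n).1 (hypos n 0).ne' (hypos n 2).ne']
  · refine hbase.congr fun n => ?_
    rw [hyrec, RicSU2_berger_two (key n).1 (hypos n 0).ne' (hypos n 2).ne']
end

section
/- Let x = (x₁,x₂,x₃) ∈ (0,∞)³. There exists a sequence (x^{(i)})_{i≤1} of elements of (0,∞)³ with x^{(1)} = x and x^{(i−1)} = R(x^{(i)}) for every integer i ≤ 1 if and only if there are distinct indices i,j,k with {i,j,k} = {1,2,3} such that x_j = x_k and x_i ≤ x_j. (Equivalently, x is, up to scaling and permutation of coordinates, a Berger triple (ν,2,2) with ν ∈ (0,2].) -/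
theorem RicSU2_apply (x : Fin 3 → ℝ) {i j k : Fin 3} (hij : i ≠ j) (hjk : j ≠ k) (hik : i ≠ k) :
    RicSU2 x i = 2 * (x i ^ 2 - (x j - x k) ^ 2) / (x j * x k) := by
  have h : j = i + 1 ∧ k = i + 2 ∨ k = i + 1 ∧ j = i + 2 := by
    revert i j k; decide
  rcases h with ⟨rfl, rfl⟩ | ⟨rfl, rfl⟩
  · rfl
  · unfold RicSU2
    rw [mul_comm (x (i + 2)), sub_sq_comm (x (i + 2))]

/-- The Ricci map preserves the order of the eigenvalues `a ≤ b`. -/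
theorem ricci_le_ricci {a b c : ℝ} (ha : 0 < a) (hb : 0 < b) (hc : 0 < c) (hab : a ≤ b)
    (hcab : c < a + b) :
    2 * (a ^ 2 - (b - c) ^ 2) / (b * c) ≤ 2 * (b ^ 2 - (a - c) ^ 2) / (a * c) := by
  rw [div_le_div_iff₀ (by positivity) (by positivity)]
  have h1 : a * (a + c - b) ≤ b * (b + c - a) := by nlinarith
  have h2 : 0 ≤ 2 * c * (a + b - c) := mul_nonneg (by positivity) (by linarith)
  nlinarith [mul_le_mul_of_nonneg_left h1 h2]

/-- The ratio of the two largest eigenvalues is at least squared by the Ricci map. -/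
theorem sq_mul_ricci_le {a b c : ℝ} (ha : 0 < a) (hb : 0 < b) (hc : 0 < c) (hab : a ≤ b)
    (hbc : b ≤ c) :
    c ^ 2 * (2 * (b ^ 2 - (a - c) ^ 2) / (a * c)) ≤
      b ^ 2 * (2 * (c ^ 2 - (a - b) ^ 2) / (a * b)) := by
  have e1 : c ^ 2 * (2 * (b ^ 2 - (a - c) ^ 2) / (a * c)) =
      2 * (b + c - a) * (c * (a + b - c)) / a := by
    field_simp; ring
  have e2 : b ^ 2 * (2 * (c ^ 2 - (a - b) ^ 2) / (a * b)) =
      2 * (b + c - a) * (b * (a + c - b)) / a := by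
    field_simp; ring
  rw [e1, e2]
  have h : c * (a + b - c) ≤ b * (a + c - b) := by nlinarith
  have h' : 0 ≤ 2 * (b + c - a) := by linarith
  gcongr

theorem lt_add_of_RicSU2_pos {x : Fin 3 → ℝ} (hx : ∀ i, 0 < x i) {i j k : Fin 3} (hij : i ≠ j)
    (hjk : j ≠ k) (hik : i ≠ k) (h : 0 < RicSU2 x j) : x k < x i + x j := by
  rw [RicSU2_apply x hij.symm hik hjk] at h
  have hpos := mul_pos (hx i) (hx k)
  rw [div_pos_iff_of_pos_right hpos] at h
  have h2 : (x i - x k) ^ 2 < x j ^ 2 := by linarith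
  have := abs_lt_of_sq_lt_sq h2 (hx j).le
  linarith [(abs_lt.mp this).1]

theorem eq_of_forall_iterate_pos {z : ℕ → Fin 3 → ℝ} (hz : ∀ n k, 0 < z n k)
    (hs : ∀ n, z (n + 1) = RicSU2 (z n)) {i j k : Fin 3} (hij : i ≠ j) (hjk : j ≠ k)
    (hik : i ≠ k) (h1 : z 0 i ≤ z 0 j) (h2 : z 0 j ≤ z 0 k) : z 0 j = z 0 k := by
  by_contra hne
  have hlt := lt_of_le_of_ne h2 hne
  obtain ⟨s, hs0⟩ : ∃ s, s = z 0 k / z 0 j := ⟨_, rfl⟩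
  have hs1 : 1 < s := by rw [hs0, one_lt_div (hz 0 j)]; exact hlt
  have htri : ∀ n, z n k < z n i + z n j := fun n =>
    lt_add_of_RicSU2_pos (hz n) hij hjk hik (hs n ▸ hz (n + 1) j)
  have key : ∀ n, z n i ≤ z n j ∧ s ^ (n + 1) * z n j ≤ z n k := by
    intro n
    induction n with
    | zero =>
      refine ⟨h1, ?_⟩
      rw [hs0, zero_add, pow_one, div_mul_cancel₀ _ (hz 0 j).ne']
    | succ n ih =>
      obtain ⟨hab, hT⟩ := ih
      have hT1 : s ≤ s ^ (n + 1) := le_self_pow₀ hs1.le (by omega)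
      have hb := hz n j
      have hbc : z n j ≤ z n k := by nlinarith
      have hRa := RicSU2_apply (z n) hij hjk hik
      have hRb := RicSU2_apply (z n) hij.symm hik hjk
      have hRc := RicSU2_apply (z n) hik.symm hij hjk.symm
      have m := sq_mul_ricci_le (hz n i) hb (hz n k) hab hbc
      have l := ricci_le_ricci (hz n i) hb (hz n k) hab (htri n)
      rw [← hRb, ← hRc, ← hs] at m
      rw [← hRb, ← hRa, ← hs] at l
      refine ⟨l, ?_⟩
      have hT0 : 0 ≤ s ^ (n + 1) := by positivity
      have hRb0 := hz (n + 1) j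
      have hsq : (s ^ (n + 1) * z n j) ^ 2 ≤ z n k ^ 2 := by gcongr
      have hmul : z n j ^ 2 * ((s ^ (n + 1)) ^ 2 * z (n + 1) j) ≤ z n j ^ 2 * z (n + 1) k := by
        nlinarith [mul_le_mul_of_nonneg_right hsq hRb0.le]
      have hfin := le_of_mul_le_mul_left hmul (by positivity)
      have hpow : s ^ (n + 1 + 1) ≤ (s ^ (n + 1)) ^ 2 := by
        rw [pow_succ s (n + 1), sq]; gcongr
      nlinarith [mul_le_mul_of_nonneg_right hpow hRb0.le]
  obtain ⟨n, hn⟩ := pow_unbounded_of_one_lt 2 hs1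
  obtain ⟨hab, hT⟩ := key n
  have hpow : s ^ n ≤ s ^ (n + 1) := pow_le_pow_right₀ hs1.le (by omega)
  nlinarith [htri n, hz n j]

theorem exists_sorted_fin_three (x : Fin 3 → ℝ) :
    ∃ i j k : Fin 3, i ≠ j ∧ j ≠ k ∧ i ≠ k ∧ x i ≤ x j ∧ x j ≤ x k := by
  rcases le_total (x 0) (x 1) with h1 | h1 <;> rcases le_total (x 1) (x 2) with h2 | h2 <;>
    rcases le_total (x 0) (x 2) with h3 | h3
  · exact ⟨0, 1, 2, by decide, by decide, by decide, h1, h2⟩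
  · exact ⟨0, 1, 2, by decide, by decide, by decide, h1, h2⟩
  · exact ⟨0, 2, 1, by decide, by decide, by decide, h3, h2⟩
  · exact ⟨2, 0, 1, by decide, by decide, by decide, h3, h1⟩
  · exact ⟨1, 0, 2, by decide, by decide, by decide, h1, h3⟩
  · exact ⟨1, 2, 0, by decide, by decide, by decide, h2, h3⟩
  · exact ⟨2, 1, 0, by decide, by decide, by decide, h2, h1⟩
  · exact ⟨2, 1, 0, by decide, by decide, by decide, h2, h1⟩

/-- Berger triples whose distinguished eigenvalue is the smallest are preserved by `RicSU2`. -/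
theorem RicSU2_berger_s11 {x : Fin 3 → ℝ} (hx : ∀ i, 0 < x i) {i j k : Fin 3} (hij : i ≠ j)
    (hjk : j ≠ k) (hik : i ≠ k) (h1 : x j = x k) (h2 : x i ≤ x j) :
    (∀ l, 0 < RicSU2 x l) ∧ RicSU2 x j = RicSU2 x k ∧ RicSU2 x i ≤ RicSU2 x j := by
  have hi := hx i
  have hj := hx j
  have hRa := RicSU2_apply x hij hjk hik
  have hRb := RicSU2_apply x hij.symm hik hjk
  have hRc := RicSU2_apply x hik.symm hij hjk.symm
  have l := ricci_le_ricci hi hj (hx k) h2 (by linarith)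
  rw [← hRa, ← hRb] at l
  have hbc : RicSU2 x j = RicSU2 x k := by rw [hRb, hRc, h1]
  have ha : 0 < RicSU2 x i := by
    rw [hRa, ← h1, sub_self]
    simp only [ne_eq, OfNat.ofNat_ne_zero, not_false_eq_true, zero_pow, sub_zero]
    positivity
  refine ⟨fun m => ?_, hbc, l⟩
  have hm : m = i ∨ m = j ∨ m = k := by
    clear * - hij hjk hik
    revert i j k m; decide
  rcases hm with rfl | rfl | rfl <;> linarith

theorem stmt_11 (x : Fin 3 → ℝ) (hx : ∀ i, 0 < x i) :
    (∃ y : ℤ → Fin 3 → ℝ,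
        (∀ i ≤ (1 : ℤ), ∀ k, 0 < y i k) ∧ y 1 = x ∧
        ∀ i ≤ (1 : ℤ), y (i - 1) = RicSU2 (y i)) ↔
    ∃ i j k : Fin 3, i ≠ j ∧ j ≠ k ∧ i ≠ k ∧ x j = x k ∧ x i ≤ x j := by
  constructor
  · rintro ⟨y, hpos, rfl, hstep⟩
    obtain ⟨i, j, k, hij, hjk, hik, h1, h2⟩ := exists_sorted_fin_three (y 1)
    refine ⟨i, j, k, hij, hjk, hik, ?_, h1⟩
    have h := eq_of_forall_iterate_pos (z := fun n : ℕ => y (1 - n))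
      (fun n => hpos _ (by omega))
      (fun n => by
        have := hstep (1 - n) (by omega)
        rwa [show (1 : ℤ) - n - 1 = 1 - (n + 1 : ℕ) by push_cast; ring] at this)
      hij hjk hik (by simpa using h1) (by simpa using h2)
    simpa using h
  · rintro ⟨i, j, k, hij, hjk, hik, h1, h2⟩
    have key : ∀ n : ℕ, (∀ l, 0 < RicSU2^[n] x l) ∧ RicSU2^[n] x j = RicSU2^[n] x k ∧
        RicSU2^[n] x i ≤ RicSU2^[n] x j := by
      intro n
      induction n with
      | zero => exact ⟨hx, h1, h2⟩
      | succ n ih =>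
        rw [Function.iterate_succ_apply']
        exact RicSU2_berger_s11 ih.1 hij hjk hik ih.2.1 ih.2.2
    refine ⟨fun m => RicSU2^[(1 - m).toNat] x, fun m _ => (key _).1, by simp, fun m hm => ?_⟩
    have : (1 - (m - 1)).toNat = (1 - m).toNat + 1 := by omega
    simp only [this, Function.iterate_succ_apply']
end

section
/- Let n ≥ 1 and let T₁, T₂, T₃ > 0 satisfy 1/T_i < 2n + 4 for i = 1, 2, 3. If x₁, x₂, x₃ > 0 and c ∈ ℝ satisfy x_{i+1} x_{i+2} c T_i = 2(x_i² − (x_{i+1} − x_{i+2})²) for i = 1, 2, 3 (indices mod 3), then c < 4n + 8. -/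
/-- If `a` is the smallest of `a, b, d > 0`, the Ricci equation for `a` alone bounds `c`. -/
theorem lt_two_mul_of_ricci_eq_of_le {a b d c T M : ℝ} (ha : 0 < a) (hab : a ≤ b) (had : a ≤ d)
    (hT : 0 < T) (hM : 1 / T < M) (e : b * d * c * T = 2 * (a ^ 2 - (b - d) ^ 2)) :
    c < 2 * M := by
  have hbd : 0 < b * d := mul_pos (ha.trans_le hab) (ha.trans_le had)
  have hsq : a * a ≤ b * d := mul_le_mul hab had ha.le (ha.le.trans hab)
  have hcT : c * T ≤ 2 := by
    refine le_of_mul_le_mul_left ?_ hbd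
    nlinarith [sq_nonneg (b - d)]
  rw [div_lt_iff₀ hT] at hM
  exact lt_of_mul_lt_mul_right (by linarith) hT.le

theorem stmt_13 (n : ℕ) (hn : 1 ≤ n) (T₁ T₂ T₃ : ℝ)
    (hT₁ : 0 < T₁) (hT₂ : 0 < T₂) (hT₃ : 0 < T₃)
    (h₁ : 1 / T₁ < 2 * n + 4) (h₂ : 1 / T₂ < 2 * n + 4) (h₃ : 1 / T₃ < 2 * n + 4)
    (x₁ x₂ x₃ : ℝ) (hx₁ : 0 < x₁) (hx₂ : 0 < x₂) (hx₃ : 0 < x₃) (c : ℝ)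
    (e₁ : x₂ * x₃ * c * T₁ = 2 * (x₁ ^ 2 - (x₂ - x₃) ^ 2))
    (e₂ : x₃ * x₁ * c * T₂ = 2 * (x₂ ^ 2 - (x₃ - x₁) ^ 2))
    (e₃ : x₁ * x₂ * c * T₃ = 2 * (x₃ ^ 2 - (x₁ - x₂) ^ 2)) :
    c < 4 * n + 8 := by
  have key : c < 2 * (2 * n + 4) := by
    rcases le_total x₁ x₂ with h12 | h12
    · rcases le_total x₁ x₃ with h13 | h13
      · exact lt_two_mul_of_ricci_eq_of_le hx₁ h12 h13 hT₁ h₁ e₁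
      · exact lt_two_mul_of_ricci_eq_of_le hx₃ h13 (h13.trans h12) hT₃ h₃ e₃
    · rcases le_total x₂ x₃ with h23 | h23
      · exact lt_two_mul_of_ricci_eq_of_le hx₂ h23 h12 hT₂ h₂ e₂
      · exact lt_two_mul_of_ricci_eq_of_le hx₃ (h23.trans h12) h23 hT₃ h₃ e₃
  linarith
end

section
/- Let n ≥ 1 and let T₁, T₂, T₃ > 0 satisfy 1/T_i < 2n + 4 for i = 1, 2, 3. Then there exist constants 0 < ε < M such that for every λ ∈ [0, 4n], every (x₁, x₂, x₃, c) ∈ (0,∞)⁴ satisfying c = (4n+8) − 2(x₁+x₂+x₃) and x_{i+1} x_{i+2} c T_i = λ x_i² x_{i+1} x_{i+2} + 2(x_i² − (x_{i+1} − x_{i+2})²) for i = 1, 2, 3 (indices mod 3) satisfies ε ≤ x_i ≤ M for i = 1,2,3 and ε ≤ c ≤ M. In particular, all such solutions lie in a bounded convex open subset of (0,∞)⁴ whose closure is contained in (0,∞)⁴. -/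
/-- Adding the equations pairwise removes the singular factors; summing cyclically yields this
identity. -/
theorem prescribed_ricci_sum_identity {T₁ T₂ T₃ lam x₁ x₂ x₃ c : ℝ}
    (hx₁ : 0 < x₁) (hx₂ : 0 < x₂) (hx₃ : 0 < x₃)
    (e₁ : x₂ * x₃ * c * T₁ = lam * x₁ ^ 2 * x₂ * x₃ + 2 * (x₁ ^ 2 - (x₂ - x₃) ^ 2))
    (e₂ : x₃ * x₁ * c * T₂ = lam * x₂ ^ 2 * x₃ * x₁ + 2 * (x₂ ^ 2 - (x₃ - x₁) ^ 2))
    (e₃ : x₁ * x₂ * c * T₃ = lam * x₃ ^ 2 * x₁ * x₂ + 2 * (x₃ ^ 2 - (x₁ - x₂) ^ 2)) :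
    c * ((x₂ + x₃) * T₁ + (x₃ + x₁) * T₂ + (x₁ + x₂) * T₃) =
      lam * (x₂ * x₃ * (x₂ + x₃) + x₃ * x₁ * (x₃ + x₁) + x₁ * x₂ * (x₁ + x₂)) +
        4 * (x₁ + x₂ + x₃) := by
  have a₁ : x₃ * c * T₂ + x₂ * c * T₃ = lam * (x₂ * x₃ * (x₂ + x₃)) + 4 * (x₂ + x₃ - x₁) :=
    mul_left_cancel₀ hx₁.ne' (by linear_combination e₂ + e₃)
  have a₂ : x₁ * c * T₃ + x₃ * c * T₁ = lam * (x₃ * x₁ * (x₃ + x₁)) + 4 * (x₃ + x₁ - x₂) :=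
    mul_left_cancel₀ hx₂.ne' (by linear_combination e₃ + e₁)
  have a₃ : x₂ * c * T₁ + x₁ * c * T₂ = lam * (x₁ * x₂ * (x₁ + x₂)) + 4 * (x₁ + x₂ - x₃) :=
    mul_left_cancel₀ hx₃.ne' (by linear_combination e₁ + e₂)
  linear_combination a₁ + a₂ + a₃

/-- The constant `c` is bounded below by `2 / (T₁ + T₂ + T₃)`. -/
theorem prescribed_ricci_const_lower_bound {T₁ T₂ T₃ lam x₁ x₂ x₃ c : ℝ}
    (hT₁ : 0 < T₁) (hT₂ : 0 < T₂) (hT₃ : 0 < T₃) (hlam : 0 ≤ lam)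
    (hx₁ : 0 < x₁) (hx₂ : 0 < x₂) (hx₃ : 0 < x₃) (hc : 0 < c)
    (hsum : c * ((x₂ + x₃) * T₁ + (x₃ + x₁) * T₂ + (x₁ + x₂) * T₃) =
      lam * (x₂ * x₃ * (x₂ + x₃) + x₃ * x₁ * (x₃ + x₁) + x₁ * x₂ * (x₁ + x₂)) +
        4 * (x₁ + x₂ + x₃)) :
    2 / (T₁ + T₂ + T₃) ≤ c := by
  rw [div_le_iff₀ (by positivity)]
  have hs : 0 < x₁ + x₂ + x₃ := by positivity
  have hq : 0 ≤ lam * (x₂ * x₃ * (x₂ + x₃) + x₃ * x₁ * (x₃ + x₁) + x₁ * x₂ * (x₁ + x₂)) := by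
    positivity
  have hr : 0 ≤ c * (x₁ * T₁ + x₂ * T₂ + x₃ * T₃) := by positivity
  have hr' : 0 ≤ c * ((x₁ + x₂ + x₃) * (T₁ + T₂ + T₃)) := by positivity
  refine le_of_mul_le_mul_left ?_ hs
  linarith

/-- The sum `x₁ + x₂ + x₃` is bounded below when every `T i` exceeds `t > 2 / A`. -/
theorem prescribed_ricci_sum_lower_bound {A t T₁ T₂ T₃ lam x₁ x₂ x₃ c : ℝ}
    (hA : 0 < A) (ht : 0 < t) (ht₁ : t ≤ T₁) (ht₂ : t ≤ T₂) (ht₃ : t ≤ T₃) (hlam : lam ≤ A)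
    (hx₁ : 0 < x₁) (hx₂ : 0 < x₂) (hx₃ : 0 < x₃) (hc : 0 < c)
    (hcA : c = A - 2 * (x₁ + x₂ + x₃))
    (hsum : c * ((x₂ + x₃) * T₁ + (x₃ + x₁) * T₂ + (x₁ + x₂) * T₃) =
      lam * (x₂ * x₃ * (x₂ + x₃) + x₃ * x₁ * (x₃ + x₁) + x₁ * x₂ * (x₁ + x₂)) +
        4 * (x₁ + x₂ + x₃)) :
    (2 * A * t - 4) / (4 * t + A ^ 2) ≤ x₁ + x₂ + x₃ := by
  rw [div_le_iff₀ (by positivity)]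
  have hs : 0 < x₁ + x₂ + x₃ := by positivity
  have hlow : c * (2 * (x₁ + x₂ + x₃) * t) ≤
      c * ((x₂ + x₃) * T₁ + (x₃ + x₁) * T₂ + (x₁ + x₂) * T₃) := by
    have b₁ : (x₂ + x₃) * t ≤ (x₂ + x₃) * T₁ := by gcongr
    have b₂ : (x₃ + x₁) * t ≤ (x₃ + x₁) * T₂ := by gcongr
    have b₃ : (x₁ + x₂) * t ≤ (x₁ + x₂) * T₃ := by gcongr
    gcongr
    linarith
  have hcube : x₂ * x₃ * (x₂ + x₃) + x₃ * x₁ * (x₃ + x₁) + x₁ * x₂ * (x₁ + x₂) ≤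
      (x₁ + x₂ + x₃) ^ 3 := by
    have : 0 ≤ x₁ ^ 3 + x₂ ^ 3 + x₃ ^ 3 + 6 * (x₁ * x₂ * x₃) +
      2 * (x₂ * x₃ * (x₂ + x₃) + x₃ * x₁ * (x₃ + x₁) + x₁ * x₂ * (x₁ + x₂)) := by positivity
    linarith
  have hup : lam * (x₂ * x₃ * (x₂ + x₃) + x₃ * x₁ * (x₃ + x₁) + x₁ * x₂ * (x₁ + x₂)) ≤
      A * (x₁ + x₂ + x₃) ^ 3 := by gcongr
  have hsq : A * (x₁ + x₂ + x₃) ^ 3 ≤ A ^ 2 * (x₁ + x₂ + x₃) ^ 2 := by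
    have h := mul_le_mul_of_nonneg_left (show x₁ + x₂ + x₃ ≤ A by linarith)
      (show 0 ≤ A * (x₁ + x₂ + x₃) ^ 2 by positivity)
    linarith
  refine le_of_mul_le_mul_left ?_ hs
  subst hcA
  linarith

/-- One equation bounds its variable by the sum of the other two. -/
theorem prescribed_ricci_triangle_bound {A T lam x y z c : ℝ}
    (hA : 0 < A) (hT : 0 < T) (hlam : 0 ≤ lam)
    (hy : 0 < y) (hz : 0 < z) (hcA : c ≤ A)
    (e : y * z * c * T = lam * x ^ 2 * y * z + 2 * (x ^ 2 - (y - z) ^ 2)) :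
    x ≤ (1 + A * T) * (y + z) := by
  have hq : 0 ≤ lam * x ^ 2 * y * z := by positivity
  have hu : y * z * c * T ≤ y * z * A * T := by gcongr
  have hAT : 0 < A * T := by positivity
  have hyz : 0 < y * z := by positivity
  refine le_of_sq_le_sq ?_ (by positivity)
  nlinarith [mul_pos hAT hyz, mul_pos hAT hAT, sq_nonneg (y + z),
    mul_nonneg hAT.le (sq_nonneg (y + z)), mul_nonneg hAT.le (sq_nonneg (y - z)),
    mul_nonneg (mul_pos hAT hAT).le (sq_nonneg (y + z))]

/-- A single coordinate is bounded below once `c` and the sum of the coordinates are. -/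
theorem prescribed_ricci_coord_lower_bound {A T₁ T₂ T₃ c₀ s₀ : ℝ} (hA : 0 < A)
    (hT₁ : 0 < T₁) (hT₂ : 0 < T₂) (hT₃ : 0 < T₃) (hc₀ : 0 < c₀) (hs₀ : 0 < s₀) :
    ∃ ε : ℝ, 0 < ε ∧ ∀ lam x₁ x₂ x₃ c : ℝ, 0 ≤ lam → lam ≤ A →
      0 < x₁ → 0 < x₂ → 0 < x₃ → x₂ ≤ A → x₃ ≤ A → c₀ ≤ c → c ≤ A → s₀ ≤ x₁ + x₂ + x₃ →
      x₂ * x₃ * c * T₁ = lam * x₁ ^ 2 * x₂ * x₃ + 2 * (x₁ ^ 2 - (x₂ - x₃) ^ 2) →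
      x₃ * x₁ * c * T₂ = lam * x₂ ^ 2 * x₃ * x₁ + 2 * (x₂ ^ 2 - (x₃ - x₁) ^ 2) →
      x₁ * x₂ * c * T₃ = lam * x₃ ^ 2 * x₁ * x₂ + 2 * (x₃ ^ 2 - (x₁ - x₂) ^ 2) →
      ε ≤ x₁ := by
  set b := 1 + A * (T₂ + T₃) with hb
  have hb0 : 0 < b := by positivity
  set p := s₀ / (2 * (1 + b)) with hp
  have hp0 : 0 < p := by positivity
  have hps : p * (2 * (1 + b)) = s₀ := by rw [hp]; field_simp
  set K := c₀ * T₁ / (A ^ 3 + 2) with hK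
  have hK0 : 0 < K := by positivity
  have hKm : K * (A ^ 3 + 2) = c₀ * T₁ := by rw [hK]; field_simp
  refine ⟨p * min 1 K, by positivity, ?_⟩
  intro lam x₁ x₂ x₃ c hlam hlamA hx₁ hx₂ hx₃ hA₂ hA₃ hc hcA hs e₁ e₂ e₃
  have hq0 : 0 < min 1 K := by positivity
  have hq1 : min 1 K ≤ 1 := min_le_left _ _
  have hqK : min 1 K ≤ K := min_le_right _ _
  have g₂ := prescribed_ricci_triangle_bound hA hT₂ hlam hx₃ hx₁ hcA e₂
  have g₃ := prescribed_ricci_triangle_bound hA hT₃ hlam hx₁ hx₂ hcA e₃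
  have g₂' : x₂ ≤ b * (x₃ + x₁) := g₂.trans (by
    have : 0 ≤ A * T₃ * (x₃ + x₁) := by positivity
    rw [hb]; linarith)
  have g₃' : x₃ ≤ b * (x₁ + x₂) := g₃.trans (by
    have : 0 ≤ A * T₂ * (x₁ + x₂) := by positivity
    rw [hb]; linarith)
  have hb1 : 0 < 1 + b := by positivity
  have k₂ : 2 * p ≤ x₁ + x₂ := le_of_mul_le_mul_right (by linarith) hb1
  have k₃ : 2 * p ≤ x₃ + x₁ := le_of_mul_le_mul_right (by linarith) hb1
  by_contra! hlt
  have hx₁p : x₁ < p := hlt.trans_le (mul_le_of_le_one_right hp0.le hq1)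
  have hpp : p * p ≤ x₂ * x₃ := by gcongr <;> linarith
  have hlow : p * p * c₀ * T₁ ≤ x₂ * x₃ * c * T₁ := by gcongr
  have hup : lam * x₁ ^ 2 * x₂ * x₃ ≤ A * x₁ ^ 2 * A * A := by gcongr
  have hsqn : 0 ≤ (x₂ - x₃) ^ 2 := sq_nonneg _
  have hbound : p * p * K ≤ x₁ ^ 2 := by
    refine le_of_mul_le_mul_right ?_ (show 0 < A ^ 3 + 2 by positivity)
    linear_combination hlow + hup + 2 * hsqn + e₁ + p * p * hKm
  have hsmall : x₁ ^ 2 < (p * min 1 K) ^ 2 := by gcongr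
  have hmin : min 1 K * min 1 K ≤ K := by nlinarith
  have : (p * min 1 K) ^ 2 ≤ p * p * K := by
    have := mul_le_mul_of_nonneg_left hmin (show 0 ≤ p * p by positivity)
    linarith
  linarith


theorem stmt_14 (n : ℕ) (hn : 1 ≤ n) (T₁ T₂ T₃ : ℝ)
    (hT₁ : 0 < T₁) (hT₂ : 0 < T₂) (hT₃ : 0 < T₃)
    (h₁ : 1 / T₁ < 2 * n + 4) (h₂ : 1 / T₂ < 2 * n + 4) (h₃ : 1 / T₃ < 2 * n + 4) :
    ∃ ε M : ℝ, 0 < ε ∧ ε < M ∧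
      (∀ lam : ℝ, 0 ≤ lam → lam ≤ 4 * n →
        ∀ x₁ x₂ x₃ c : ℝ, 0 < x₁ → 0 < x₂ → 0 < x₃ → 0 < c →
          c = (4 * n + 8) - 2 * (x₁ + x₂ + x₃) →
          x₂ * x₃ * c * T₁ = lam * x₁ ^ 2 * x₂ * x₃ + 2 * (x₁ ^ 2 - (x₂ - x₃) ^ 2) →
          x₃ * x₁ * c * T₂ = lam * x₂ ^ 2 * x₃ * x₁ + 2 * (x₂ ^ 2 - (x₃ - x₁) ^ 2) →
          x₁ * x₂ * c * T₃ = lam * x₃ ^ 2 * x₁ * x₂ + 2 * (x₃ ^ 2 - (x₁ - x₂) ^ 2) →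
          (ε ≤ x₁ ∧ x₁ ≤ M) ∧ (ε ≤ x₂ ∧ x₂ ≤ M) ∧ (ε ≤ x₃ ∧ x₃ ≤ M) ∧
            ε ≤ c ∧ c ≤ M) ∧
      ∃ Ω : Set (ℝ × ℝ × ℝ × ℝ), IsOpen Ω ∧ Convex ℝ Ω ∧ Bornology.IsBounded Ω ∧
        closure Ω ⊆ {p : ℝ × ℝ × ℝ × ℝ |
          0 < p.1 ∧ 0 < p.2.1 ∧ 0 < p.2.2.1 ∧ 0 < p.2.2.2} ∧
        ∀ lam : ℝ, 0 ≤ lam → lam ≤ 4 * n →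
          ∀ x₁ x₂ x₃ c : ℝ, 0 < x₁ → 0 < x₂ → 0 < x₃ → 0 < c →
            c = (4 * n + 8) - 2 * (x₁ + x₂ + x₃) →
            x₂ * x₃ * c * T₁ = lam * x₁ ^ 2 * x₂ * x₃ + 2 * (x₁ ^ 2 - (x₂ - x₃) ^ 2) →
            x₃ * x₁ * c * T₂ = lam * x₂ ^ 2 * x₃ * x₁ + 2 * (x₂ ^ 2 - (x₃ - x₁) ^ 2) →
            x₁ * x₂ * c * T₃ = lam * x₃ ^ 2 * x₁ * x₂ + 2 * (x₃ ^ 2 - (x₁ - x₂) ^ 2) →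
            (x₁, x₂, x₃, c) ∈ Ω := by
  have hA : (0 : ℝ) < 4 * n + 8 := by positivity
  obtain ⟨t, ht, hAt, ht₁, ht₂, ht₃⟩ : ∃ t : ℝ, 0 < t ∧ 0 < 2 * (4 * n + 8) * t - 4 ∧
      t ≤ T₁ ∧ t ≤ T₂ ∧ t ≤ T₃ := by
    rw [div_lt_iff₀ (by assumption)] at h₁ h₂ h₃
    refine ⟨min T₁ (min T₂ T₃), by positivity, ?_, by simp, by simp, by simp⟩
    rcases min_choice T₁ (min T₂ T₃) with h | h
    · rw [h]; linarith
    · rw [h]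
      rcases min_choice T₂ T₃ with h' | h' <;> rw [h'] <;> linarith
  have hc₀ : 0 < 2 / (T₁ + T₂ + T₃) := by positivity
  have hs₀ : 0 < (2 * (4 * n + 8) * t - 4) / (4 * t + (4 * n + 8) ^ 2) :=
    div_pos hAt (by positivity)
  obtain ⟨ε₁, hε₁, H₁⟩ := prescribed_ricci_coord_lower_bound hA hT₁ hT₂ hT₃ hc₀ hs₀
  obtain ⟨ε₂, hε₂, H₂⟩ := prescribed_ricci_coord_lower_bound hA hT₂ hT₃ hT₁ hc₀ hs₀
  obtain ⟨ε₃, hε₃, H₃⟩ := prescribed_ricci_coord_lower_bound hA hT₃ hT₁ hT₂ hc₀ hs₀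
  obtain ⟨ε, hε, hε1, hεc, hεε₁, hεε₂, hεε₃⟩ : ∃ ε : ℝ, 0 < ε ∧ ε ≤ 1 ∧
      ε ≤ 2 / (T₁ + T₂ + T₃) ∧ ε ≤ ε₁ ∧ ε ≤ ε₂ ∧ ε ≤ ε₃ :=
    ⟨min 1 (min (2 / (T₁ + T₂ + T₃)) (min ε₁ (min ε₂ ε₃))),
      by positivity, by simp, by simp, by simp, by simp, by simp⟩
  have key : ∀ lam : ℝ, 0 ≤ lam → lam ≤ 4 * n →
      ∀ x₁ x₂ x₃ c : ℝ, 0 < x₁ → 0 < x₂ → 0 < x₃ → 0 < c →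
        c = (4 * n + 8) - 2 * (x₁ + x₂ + x₃) →
        x₂ * x₃ * c * T₁ = lam * x₁ ^ 2 * x₂ * x₃ + 2 * (x₁ ^ 2 - (x₂ - x₃) ^ 2) →
        x₃ * x₁ * c * T₂ = lam * x₂ ^ 2 * x₃ * x₁ + 2 * (x₂ ^ 2 - (x₃ - x₁) ^ 2) →
        x₁ * x₂ * c * T₃ = lam * x₃ ^ 2 * x₁ * x₂ + 2 * (x₃ ^ 2 - (x₁ - x₂) ^ 2) →
        (ε ≤ x₁ ∧ x₁ ≤ 4 * n + 8) ∧ (ε ≤ x₂ ∧ x₂ ≤ 4 * n + 8) ∧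
          (ε ≤ x₃ ∧ x₃ ≤ 4 * n + 8) ∧ ε ≤ c ∧ c ≤ 4 * n + 8 := by
    intro lam hlam hlamn x₁ x₂ x₃ c hx₁ hx₂ hx₃ hc hcA e₁ e₂ e₃
    have hlamA : lam ≤ 4 * n + 8 := by linarith
    have hsum := prescribed_ricci_sum_identity hx₁ hx₂ hx₃ e₁ e₂ e₃
    have hc' := prescribed_ricci_const_lower_bound hT₁ hT₂ hT₃ hlam hx₁ hx₂ hx₃ hc hsum
    have hs := prescribed_ricci_sum_lower_bound hA ht ht₁ ht₂ ht₃ hlamA hx₁ hx₂ hx₃ hc hcA hsum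
    have u₁ : x₁ ≤ 4 * n + 8 := by linarith
    have u₂ : x₂ ≤ 4 * n + 8 := by linarith
    have u₃ : x₃ ≤ 4 * n + 8 := by linarith
    have uc : c ≤ 4 * n + 8 := by linarith
    exact ⟨⟨hεε₁.trans (H₁ lam x₁ x₂ x₃ c hlam hlamA hx₁ hx₂ hx₃ u₂ u₃ hc' uc hs e₁ e₂ e₃), u₁⟩,
      ⟨hεε₂.trans (H₂ lam x₂ x₃ x₁ c hlam hlamA hx₂ hx₃ hx₁ u₃ u₁ hc' uc
        (by linarith) e₂ e₃ e₁), u₂⟩,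
      ⟨hεε₃.trans (H₃ lam x₃ x₁ x₂ c hlam hlamA hx₃ hx₁ hx₂ u₁ u₂ hc' uc
        (by linarith) e₃ e₁ e₂), u₃⟩, hεc.trans hc', uc⟩
  refine ⟨ε, 4 * n + 8, hε, by linarith [n.cast_nonneg (α := ℝ)], key, ?_⟩
  set I : Set ℝ := Set.Ioo (ε / 2) (4 * n + 9)
  have hIo : IsOpen I := isOpen_Ioo
  have hIc : Convex ℝ I := convex_Ioo _ _
  have hIb : Bornology.IsBounded I := Metric.isBounded_Ioo _ _
  have hIpos : ∀ y ∈ closure I, 0 < y := fun y hy =>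
    (half_pos hε).trans_le (closure_minimal Set.Ioo_subset_Icc_self isClosed_Icc hy).1
  have hmem : ∀ y, ε ≤ y → y ≤ 4 * n + 8 → y ∈ I := fun y hy hy' =>
    ⟨by linarith, by linarith⟩
  refine ⟨I ×ˢ I ×ˢ I ×ˢ I, hIo.prod (hIo.prod (hIo.prod hIo)),
    hIc.prod (hIc.prod (hIc.prod hIc)), hIb.prod (hIb.prod (hIb.prod hIb)), ?_, ?_⟩
  · simp only [closure_prod_eq]
    rintro p ⟨m₁, m₂, m₃, m₄⟩
    exact ⟨hIpos _ m₁, hIpos _ m₂, hIpos _ m₃, hIpos _ m₄⟩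
  · intro lam hlam hlamn x₁ x₂ x₃ c hx₁ hx₂ hx₃ hc hcA e₁ e₂ e₃
    obtain ⟨⟨l₁, u₁⟩, ⟨l₂, u₂⟩, ⟨l₃, u₃⟩, lc, uc⟩ :=
      key lam hlam hlamn x₁ x₂ x₃ c hx₁ hx₂ hx₃ hc hcA e₁ e₂ e₃
    exact ⟨hmem _ l₁ u₁, hmem _ l₂ u₂, hmem _ l₃ u₃, hmem _ lc uc⟩
end

section
/- Let n ≥ 1 and let t, s > 0. There exist t', s' > 0 and c > 0 such that 2 + 4n t'²/s'² = c t and 4n + 8 − 6 t'/s' = c s if and only if t/s > 1/(2n + 4). -/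
theorem stmt_17 (n : ℕ) (hn : 1 ≤ n) (t s : ℝ) (ht : 0 < t) (hs : 0 < s) :
    (∃ t' s' c : ℝ, 0 < t' ∧ 0 < s' ∧ 0 < c ∧
        2 + 4 * n * t' ^ 2 / s' ^ 2 = c * t ∧
        4 * n + 8 - 6 * t' / s' = c * s) ↔ 1 / (2 * n + 4) < t / s := by
  rw [div_lt_div_iff₀ (by positivity) hs]
  constructor
  · rintro ⟨t', s', c, ht', hs', -, h₁, h₂⟩
    have hx : 0 < 6 * t' / s' := by positivity
    have hy : 0 ≤ 4 * n * t' ^ 2 / s' ^ 2 := by positivity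
    have key : (2 + 4 * n * t' ^ 2 / s' ^ 2) * s = (4 * n + 8 - 6 * t' / s') * t := by
      rw [h₁, h₂]
      ring
    linarith [mul_pos hx ht, mul_nonneg hy hs.le]
  · intro h
    have hX : (0 : ℝ) ≤ (4 * n + 8) / 6 := by positivity
    have hcont : ContinuousOn
        (fun x : ℝ ↦ (2 + 4 * n * x ^ 2) * s - (4 * n + 8 - 6 * x) * t)
        (Set.Icc 0 ((4 * n + 8) / 6)) := by fun_prop
    have hend : 0 < (2 + 4 * n * ((4 * n + 8) / 6 : ℝ) ^ 2) * s := by positivity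
    obtain ⟨x, ⟨hx, -⟩, hroot⟩ := intermediate_value_Ioo hX hcont
      (show (0 : ℝ) ∈ Set.Ioo _ _ from ⟨by linarith, by linarith⟩)
    dsimp only at hroot
    refine ⟨x, 1, (2 + 4 * n * x ^ 2) / t, hx, one_pos, by positivity, by field_simp, ?_⟩
    field_simp
    linarith
end

section
/- Let n ≥ 1 and define f = (f₁,f₂,f₃) on Ω = {x ∈ (0,∞)³ : x₁ + x₂ + x₃ < 2n + 4} by f_i(x₁,x₂,x₃) = (4n x_i² + 2(x_i + x_{i+1} − x_{i+2})(x_i + x_{i+2} − x_{i+1})/(x_{i+1} x_{i+2})) / ((4n+8) − 2(x₁+x₂+x₃)) (indices mod 3). Then there exists an open neighborhood U ⊆ (0,∞)³ of (1,1,1) such that for every y ∈ U there is a sequence (x^{(k)})_{k≥1} of elements of Ω with f(x^{(1)}) = y, f(x^{(k+1)}) = x^{(k)} for all k ≥ 1, and x^{(k)} → (1,1,1) as k → ∞. -/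
open Filter Topology

/-- The map `f` giving the inverse Ricci iteration step on the normalized
`Sp(n+1)`-invariant metrics `g_{(x₁,x₂,x₃,1)}` on `S^{4n+3}` (indices mod 3):
`f_i(x) = (4n x_i² + 2(x_i + x_{i+1} − x_{i+2})(x_i + x_{i+2} − x_{i+1})/(x_{i+1} x_{i+2}))
  / ((4n+8) − 2(x₁+x₂+x₃))`. -/
noncomputable def fIter (n : ℕ) (x : Fin 3 → ℝ) : Fin 3 → ℝ :=
  fun i =>
    (4 * n * x i ^ 2 +
      2 * (x i + x (i + 1) - x (i + 2)) * (x i + x (i + 2) - x (i + 1)) /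
        (x (i + 1) * x (i + 2))) /
    ((4 * n + 8) - 2 * (x 0 + x 1 + x 2))

/-- The derivative of the `i`-th component of `fIter n` at `(1,1,1)` is
`(4n+3)/(2n+1)` times the `i`-th coordinate. -/
theorem hasStrictFDerivAt_fIter_apply (n : ℕ) (i : Fin 3) :
    HasStrictFDerivAt (fun x => fIter n x i)
      (((4 * n + 3) / (2 * n + 1) : ℝ) • ContinuousLinearMap.proj (R := ℝ) (φ := fun _ => ℝ) i)
      (fun _ => (1 : ℝ)) := by
  have p (j : Fin 3) : HasStrictFDerivAt (fun x : Fin 3 → ℝ => x j)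
      (ContinuousLinearMap.proj (R := ℝ) (φ := fun _ => ℝ) j) (fun _ => (1 : ℝ)) :=
    hasStrictFDerivAt_apply j _
  have hn : (2 * n + 1 : ℝ) ≠ 0 := by positivity
  have hd : (4 * n + 8 : ℝ) - 2 * (1 + 1 + 1) ≠ 0 := by
    have : (4 * n + 8 : ℝ) - 2 * (1 + 1 + 1) = 2 * (2 * n + 1) := by ring
    rw [this]
    positivity
  have hinv := (hasStrictDerivAt_inv (by simp)).comp_hasStrictFDerivAt (fun _ => (1 : ℝ))
    ((p (i + 1)).fun_mul (p (i + 2)))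
  have hnum := (((p i).pow 2).const_mul (4 * n : ℝ)).fun_add
    (((((p i).fun_add (p (i + 1))).fun_sub (p (i + 2))).const_mul 2).fun_mul
      (((p i).fun_add (p (i + 2))).fun_sub (p (i + 1))) |>.fun_mul hinv)
  have hden := (hasStrictDerivAt_inv hd).comp_hasStrictFDerivAt (fun _ => (1 : ℝ))
    (((((p 0).fun_add (p 1)).fun_add (p 2)).const_mul 2).const_sub (4 * n + 8 : ℝ))
  have h := hnum.fun_mul hden
  simp only [fIter, div_eq_mul_inv]
  refine h.congr_fderiv ?_
  ext v
  fin_cases i <;> simp <;> field_simp <;> ring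

theorem hasStrictFDerivAt_fIter (n : ℕ) :
    HasStrictFDerivAt (fIter n)
      (((4 * n + 3) / (2 * n + 1) : ℝ) • ContinuousLinearMap.id ℝ (Fin 3 → ℝ))
      (fun _ => (1 : ℝ)) :=
  hasStrictFDerivAt_pi'.2 fun i => hasStrictFDerivAt_fIter_apply n i

theorem fIter_one (n : ℕ) : fIter n (fun _ => 1) = fun _ => 1 := by
  ext i
  have hd : (4 * n + 8 : ℝ) - 2 * (1 + 1 + 1) = 2 * (2 * n + 1) := by ring
  have hn : (2 * n + 1 : ℝ) ≠ 0 := by positivity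
  simp only [fIter, hd]
  field_simp
  ring

/-- Near a fixed point at which the derivative is a homothety of ratio greater than `1`, every
point has a backward orbit which stays in a prescribed ball and converges to the fixed point. -/
theorem HasStrictFDerivAt.exists_backward_orbit {E : Type*} [NormedAddCommGroup E]
    [NormedSpace ℝ E] [CompleteSpace E] {f : E → E} {p : E} {c : ℝ} (hc : 1 < c)
    (hf : HasStrictFDerivAt f (c • ContinuousLinearMap.id ℝ E) p) (hp : f p = p)
    {r : ℝ} (hr : 0 < r) :
    ∃ δ, 0 < δ ∧ δ ≤ r ∧ ∀ y ∈ Metric.ball p δ, ∃ x : ℕ → E,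
      (∀ k, x k ∈ Metric.ball p δ) ∧ f (x 0) = y ∧ (∀ k, f (x (k + 1)) = x k) ∧
      Tendsto x atTop (𝓝 p) := by
  have hc0 : 0 < c := one_pos.trans hc
  have hinv : c⁻¹ < 1 := inv_lt_one_of_one_lt₀ hc
  obtain ⟨q, hcq, hq⟩ := exists_between hinv
  have hq0 : 0 < q := (inv_pos.2 hc0).trans hcq
  let e : E ≃L[ℝ] E := ContinuousLinearEquiv.equivOfInverse
    (c • ContinuousLinearMap.id ℝ E) (c⁻¹ • ContinuousLinearMap.id ℝ E)
    (fun v => by simp [smul_smul, hc0.ne']) (fun v => by simp [smul_smul, hc0.ne'])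
  have he : HasStrictFDerivAt f (e : E →L[ℝ] E) p := hf
  let g := he.localInverse f e p
  have hgp : g p = p := by
    have := he.localInverse_apply_image
    rwa [hp] at this
  have hfg : ∀ᶠ y in 𝓝 p, f (g y) = y := by
    have := he.eventually_right_inverse
    rwa [hp] at this
  have hg : HasFDerivAt g (c⁻¹ • ContinuousLinearMap.id ℝ E) p := by
    have := he.to_localInverse.hasFDerivAt
    rw [hp] at this
    exact this
  have hcontr : ∀ᶠ y in 𝓝 p, ‖g y - p‖ ≤ q * ‖y - p‖ := by
    filter_upwards [hg.isLittleO.def (sub_pos.2 hcq)] with y hy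
    rw [hgp] at hy
    have h1 := norm_le_norm_add_norm_sub' (g y - p) (c⁻¹ • (y - p))
    rw [norm_smul, Real.norm_of_nonneg (inv_pos.2 hc0).le] at h1
    simp only [smul_apply, ContinuousLinearMap.id_apply] at hy
    linarith
  obtain ⟨ε, hε, hball⟩ := Metric.eventually_nhds_iff_ball.1 (hfg.and hcontr)
  refine ⟨min ε r, lt_min hε hr, min_le_right _ _, fun y hy => ?_⟩
  have hstep : ∀ z ∈ Metric.ball p (min ε r), f (g z) = z ∧ ‖g z - p‖ ≤ q * ‖z - p‖ :=
    fun z hz => hball z (Metric.ball_subset_ball (min_le_left _ _) hz)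
  have hmaps : ∀ z ∈ Metric.ball p (min ε r), g z ∈ Metric.ball p (min ε r) := by
    intro z hz
    have h1 := (hstep z hz).2
    rw [mem_ball_iff_norm] at hz ⊢
    nlinarith [norm_nonneg (z - p)]
  have hmem : ∀ k, g^[k] y ∈ Metric.ball p (min ε r) := by
    intro k
    induction k with
    | zero => exact hy
    | succ k ih => rw [Function.iterate_succ_apply']; exact hmaps _ ih
  have hbound : ∀ k, ‖g^[k] y - p‖ ≤ q ^ k * ‖y - p‖ := by
    intro k
    induction k with
    | zero => simp
    | succ k ih =>
      rw [Function.iterate_succ_apply', pow_succ', mul_assoc]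
      exact (hstep _ (hmem k)).2.trans (mul_le_mul_of_nonneg_left ih hq0.le)
  have hlim : Tendsto (fun k => g^[k] y) atTop (𝓝 p) := by
    refine tendsto_iff_norm_sub_tendsto_zero.2
      (squeeze_zero (fun _ => norm_nonneg _) hbound ?_)
    simpa using (tendsto_pow_atTop_nhds_zero_of_lt_one hq0.le hq).mul_const ‖y - p‖
  refine ⟨fun k => g^[k + 1] y, fun k => hmem _, (hstep y hy).1, fun k => ?_,
    (tendsto_add_atTop_iff_nat 1).2 hlim⟩
  dsimp only
  rw [Function.iterate_succ_apply' g (k + 1)]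
  exact (hstep _ (hmem _)).1

theorem stmt_18 (n : ℕ) (hn : 1 ≤ n) :
    ∃ U : Set (Fin 3 → ℝ), IsOpen U ∧ (fun _ => (1 : ℝ)) ∈ U ∧
      (∀ y ∈ U, ∀ i, 0 < y i) ∧
      ∀ y ∈ U, ∃ x : ℕ → Fin 3 → ℝ,
        (∀ k, (∀ i, 0 < x k i) ∧ x k 0 + x k 1 + x k 2 < 2 * n + 4) ∧
        fIter n (x 0) = y ∧ (∀ k, fIter n (x (k + 1)) = x k) ∧
        Tendsto x atTop (𝓝 fun _ => (1 : ℝ)) := by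
  have hc : (1 : ℝ) < (4 * n + 3) / (2 * n + 1) := by
    rw [one_lt_div (by positivity)]
    have : (0 : ℝ) ≤ n := n.cast_nonneg
    linarith
  obtain ⟨δ, hδ, hδ1, h⟩ :=
    (hasStrictFDerivAt_fIter n).exists_backward_orbit hc (fIter_one n) one_pos
  have hcoord : ∀ y ∈ Metric.ball (fun _ => (1 : ℝ)) δ, ∀ i : Fin 3, 0 < y i ∧ y i < 2 := by
    intro y hy i
    have h1 := (dist_le_pi_dist y (fun _ => (1 : ℝ)) i).trans_lt (Metric.mem_ball.1 hy)
    rw [Real.dist_eq, abs_lt] at h1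
    constructor <;> linarith
  refine ⟨Metric.ball (fun _ => 1) δ, Metric.isOpen_ball, Metric.mem_ball_self hδ,
    fun y hy i => (hcoord y hy i).1, fun y hy => ?_⟩
  obtain ⟨x, hx, hx0, hxs, hlim⟩ := h y hy
  refine ⟨x, fun k => ⟨fun i => (hcoord _ (hx k) i).1, ?_⟩, hx0, hxs, hlim⟩
  have hn' : (1 : ℝ) ≤ n := by exact_mod_cast hn
  linarith [(hcoord _ (hx k) 0).2, (hcoord _ (hx k) 1).2, (hcoord _ (hx k) 2).2]
end

section
/- Let n ≥ 1 and let x₁, x₂, x₃ > 0. If there exists a ∈ ℝ such that 4n x_i² + 2(x_i² − (x_{i+1} − x_{i+2})²)/(x_{i+1} x_{i+2}) = a for all i = 1, 2, 3 (indices mod 3), then x₁ = x₂ = x₃. -/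
/-- If two vertical components of the Ricci curvature agree, then either the corresponding
parameters agree, or the third parameter is at least their sum. -/
theorem eq_or_add_le_of_vertical_ricci_eq {c x y z : ℝ} (hc : 0 ≤ c)
    (hx : 0 < x) (hy : 0 < y) (hz : 0 < z)
    (h : 4 * c * x ^ 2 + 2 * (x ^ 2 - (y - z) ^ 2) / (y * z) =
      4 * c * y ^ 2 + 2 * (y ^ 2 - (z - x) ^ 2) / (z * x)) :
    x = y ∨ x + y ≤ z := by
  have key : (x - y) * (2 * c * (x * y * z) * (x + y) + (x + y) ^ 2 - z ^ 2) = 0 := by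
    field_simp at h
    linear_combination h / 2
  refine (mul_eq_zero.mp key).imp sub_eq_zero.mp fun hsum => ?_
  have : 0 ≤ 2 * c * (x * y * z) * (x + y) := by positivity
  exact le_of_abs_le (abs_le_of_sq_le_sq (by linarith) hz.le)

theorem stmt_19 (n : ℕ) (hn : 1 ≤ n) (x₁ x₂ x₃ : ℝ)
    (hx₁ : 0 < x₁) (hx₂ : 0 < x₂) (hx₃ : 0 < x₃) (a : ℝ)
    (e₁ : 4 * n * x₁ ^ 2 + 2 * (x₁ ^ 2 - (x₂ - x₃) ^ 2) / (x₂ * x₃) = a)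
    (e₂ : 4 * n * x₂ ^ 2 + 2 * (x₂ ^ 2 - (x₃ - x₁) ^ 2) / (x₃ * x₁) = a)
    (e₃ : 4 * n * x₃ ^ 2 + 2 * (x₃ ^ 2 - (x₁ - x₂) ^ 2) / (x₁ * x₂) = a) :
    x₁ = x₂ ∧ x₂ = x₃ := by
  have hc : (0 : ℝ) ≤ n := n.cast_nonneg
  have h₁₂ := eq_or_add_le_of_vertical_ricci_eq hc hx₁ hx₂ hx₃ (e₁.trans e₂.symm)
  have h₂₃ := eq_or_add_le_of_vertical_ricci_eq hc hx₂ hx₃ hx₁ (e₂.trans e₃.symm)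
  have h₃₁ := eq_or_add_le_of_vertical_ricci_eq hc hx₃ hx₁ hx₂ (e₃.trans e₁.symm)
  rcases h₁₂ with h₁₂ | h₁₂ <;> rcases h₂₃ with h₂₃ | h₂₃ <;> rcases h₃₁ with h₃₁ | h₃₁ <;>
    constructor <;> linarith
end
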